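/- Let W be a two-parameter Brownian motion on [0,1]² and let f : ℝ → ℝ be bounded and measurable. For every m ≥ 1, every points z_1 = (s_1,t_1), …, z_m = (s_m,t_m) in [0,1]², every u_1, …, u_m ∈ ℝ and every bounded real random variable Z on (Ω,F,P), one has, as n → ∞: E[Z · exp(i Σ_{k=1}^{m} u_k Xⁿ_{z_k})] → E[Z · exp(−Σ_{k,k'=1}^{m} u_k u_{k'} ∫_{[0, s_k ∧ s_{k'}]×[0, t_k ∧ t_{k'}]} f(W_ρ)² dρ)]. This is the F-stable finite-dimensional convergence in law of the processes Xⁿ to the process X_z = √2 ∫_{[0,z]} f(W_ρ) dB_ρ defined on a very good extension, B being a two-parameter Brownian motion independent of W. -/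

import Mathlib

open MeasureTheory ProbabilityTheory Filter Topology

/-- A two-parameter Brownian motion (Brownian sheet) on `[0,1]²`. -/
def IsBrownianSheet {Ω : Type*} [MeasurableSpace Ω] (P : Measure Ω)
    (W : ℝ × ℝ → Ω → ℝ) : Prop :=
  (∀ z, Measurable (W z)) ∧
  (∀ᵐ ω ∂P, Continuous fun z => W z ω) ∧
  ∀ (m : ℕ) (z : Fin m → ℝ × ℝ), (∀ k, z k ∈ Set.Icc ((0:ℝ), (0:ℝ)) (1, 1)) →
    ∀ c : Fin m → ℝ,
      Measure.map (fun ω => ∑ k, c k * W (z k) ω) P =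
        gaussianReal 0 (Real.toNNReal (∑ k, ∑ k', c k * c k' *
          (min (z k).1 (z k').1 * min (z k).2 (z k').2)))

/-- The weighted quadratic variations process. -/
noncomputable def wqv {Ω : Type*} (W : ℝ × ℝ → Ω → ℝ) (f : ℝ → ℝ) (n : ℕ)
    (s t : ℝ) (ω : Ω) : ℝ :=
  n * ∑ i ∈ Finset.Icc 1 (Nat.floor ((n : ℝ) * s)),
      ∑ j ∈ Finset.Icc 1 (Nat.floor ((n : ℝ) * t)),
    f (W (((i : ℝ) - 1) / n, ((j : ℝ) - 1) / n) ω) *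
      ((W (((i : ℝ) - 1) / n, ((j : ℝ) - 1) / n) ω + W ((i : ℝ) / n, (j : ℝ) / n) ω
          - W (((i : ℝ) - 1) / n, (j : ℝ) / n) ω
          - W ((i : ℝ) / n, ((j : ℝ) - 1) / n) ω) ^ 2
        - 1 / (n : ℝ) ^ 2)

/-- Second order Taylor estimate for the complex exponential on the imaginary axis. -/
lemma norm_cexp_I_mul_sub_taylor_two_le (x : ℝ) :
    ‖Complex.exp (Complex.I * x) - (1 + Complex.I * x - (x : ℂ) ^ 2 / 2)‖ ≤ 4 * |x| ^ 3 := by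
  rcases le_total |x| 1 with hx | hx
  · have h := Complex.norm_exp_sub_sum_le_norm_mul_exp (Complex.I * x) 3
    simp only [Finset.sum_range_succ, Finset.sum_range_zero, Complex.norm_mul, Complex.norm_I,
      Complex.norm_real, Real.norm_eq_abs, one_mul] at h
    have e : (0 + (Complex.I * (x : ℂ)) ^ 0 / (Nat.factorial 0 : ℂ)
        + (Complex.I * (x : ℂ)) ^ 1 / (Nat.factorial 1 : ℂ)
        + (Complex.I * (x : ℂ)) ^ 2 / (Nat.factorial 2 : ℂ))
        = 1 + Complex.I * x - (x : ℂ) ^ 2 / 2 := by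
      simp [mul_pow, Nat.factorial]; ring
    rw [e] at h
    have h3 : Real.exp |x| ≤ 4 :=
      (Real.exp_le_exp.2 hx).trans (by linarith [Real.exp_one_lt_d9])
    nlinarith [pow_nonneg (abs_nonneg x) 3]
  · calc _ ≤ ‖Complex.exp (Complex.I * x)‖ + (‖(1:ℂ)‖ + ‖Complex.I * (x:ℂ)‖ + ‖(x:ℂ)^2/2‖) := by
          refine (norm_sub_le _ _).trans (add_le_add le_rfl ?_)
          exact (norm_sub_le _ _).trans (add_le_add (norm_add_le _ _) le_rfl)
      _ = 1 + (1 + |x| + |x|^2/2) := by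
          rw [Complex.norm_exp_I_mul_ofReal]; simp
      _ ≤ _ := by nlinarith [pow_le_pow_left₀ zero_le_one hx 2, mul_nonneg (abs_nonneg x) (sub_nonneg.2 hx), pow_succ |x| 2, mul_nonneg (sq_nonneg |x|) (sub_nonneg.2 hx)]

lemma integrable_pow_gaussianReal (n : ℕ) :
    Integrable (fun x : ℝ => x ^ n) (gaussianReal 0 1) := by
  have h := (memLp_id_gaussianReal (μ := 0) (v := 1) (n : NNReal))
  rcases Nat.eq_zero_or_pos n with rfl | hn
  · simp
  · have := h.integrable_norm_pow hn.ne'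
    refine this.mono' (by fun_prop) (ae_of_all _ fun x => by simp)

lemma integral_pow_two_gaussianReal : ∫ x, x ^ 2 ∂(gaussianReal 0 1) = 1 := by
  have h := variance_fun_id_gaussianReal (μ := 0) (v := 1)
  rw [variance_of_integral_eq_zero (by fun_prop) (by simp [integral_id_gaussianReal])] at h
  simpa using h

lemma integral_pow_three_gaussianReal : ∫ x, x ^ 3 ∂(gaussianReal 0 1) = 0 := by
  have h : ∫ x, x ^ 3 ∂(gaussianReal 0 1) = ∫ x, (-x) ^ 3 ∂(gaussianReal 0 1) := by
    conv_lhs => rw [← neg_zero, ← gaussianReal_map_neg]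
    rw [integral_map (by fun_prop) (by fun_prop)]
  have h2 : ∫ x : ℝ, (-x) ^ 3 ∂(gaussianReal 0 1) = - ∫ x, x ^ 3 ∂(gaussianReal 0 1) := by
    rw [← integral_neg]; congr 1; ext x; ring
  linarith

lemma integral_pow_four_gaussianReal : ∫ x, x ^ 4 ∂(gaussianReal 0 1) = 3 := by
  rw [integral_gaussianReal_eq_integral_smul one_ne_zero]
  have h := integral_comp_abs (f := fun x : ℝ => (√(2 * Real.pi))⁻¹ * (x ^ (4:ℝ) * Real.exp (- (1/2) * x ^ (2:ℝ))))
  have hg := integral_rpow_mul_exp_neg_mul_rpow (p := 2) (q := 4) (b := 1/2)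
    (by norm_num) (by norm_num) (by norm_num)
  have h5 : Real.Gamma ((4+1)/2) = 3 / 4 * √Real.pi := by
    rw [show ((4:ℝ)+1)/2 = (1/2 + 1) + 1 by norm_num, Real.Gamma_add_one (by norm_num),
      Real.Gamma_add_one (by norm_num), Real.Gamma_one_half_eq]; ring
  rw [integral_const_mul, integral_const_mul, hg, h5] at h
  have e : ∀ x : ℝ, gaussianPDFReal 0 1 x • x ^ 4
      = (√(2 * Real.pi))⁻¹ * (|x| ^ (4:ℝ) * Real.exp (- (1/2) * |x| ^ (2:ℝ))) := by
    intro x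
    have e4 : |x| ^ (4:ℝ) = x ^ 4 := by
      rw [show (4:ℝ) = ((4:ℕ):ℝ) by norm_num, Real.rpow_natCast, Even.pow_abs (by decide)]
    have e2 : |x| ^ (2:ℝ) = x ^ 2 := by
      rw [show (2:ℝ) = ((2:ℕ):ℝ) by norm_num, Real.rpow_natCast, sq_abs]
    rw [e4, e2, gaussianPDFReal, smul_eq_mul]
    simp only [NNReal.coe_one, mul_one, sub_zero]
    rw [show -x ^ 2 / 2 = -(1/2) * x ^2 by ring]; ring
  simp_rw [e]
  rw [integral_const_mul, h]
  have hb : ((1:ℝ)/2) ^ (-((4:ℝ)+1)/2) = 4 * √2 := by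
    rw [show -((4:ℝ)+1)/2 = -(2 + 1/2) by norm_num, one_div, Real.inv_rpow (by norm_num), Real.rpow_neg (by norm_num), inv_inv,
      Real.rpow_add (by norm_num), Real.sqrt_eq_rpow]
    norm_num
  rw [hb, Real.sqrt_mul (by norm_num)]
  have : √Real.pi ≠ 0 := by positivity
  field_simp

lemma abs_exp_neg_sub_le {y : ℝ} (hy : 0 ≤ y) : |1 - y - Real.exp (-y)| ≤ y ^ 2 := by
  have h1 : 1 - y ≤ Real.exp (-y) := by linarith [Real.add_one_le_exp (-y)]
  rw [abs_of_nonpos (by linarith)]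
  have h2 : Real.exp (-y) * (1 + y) ≤ 1 := by
    have := Real.add_one_le_exp y
    calc _ ≤ Real.exp (-y) * Real.exp y := by gcongr; linarith
      _ = 1 := by rw [← Real.exp_add]; simp
  have h3 : 0 < Real.exp (-y) := Real.exp_pos _
  have h4 : Real.exp (-y) ≤ 1 := Real.exp_le_one_iff.2 (by linarith)
  nlinarith [mul_nonneg hy hy, mul_nonneg h3.le hy]

/-- Expansion of the characteristic function of `b N + a (N² - 1)` for a standard Gaussian `N`. -/
lemma exists_norm_integral_cexp_gaussianReal_sub_le (A B : ℝ) : ∃ K : ℝ, 0 ≤ K ∧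
    ∀ a b t : ℝ, |a| ≤ A → |b| ≤ B → 0 ≤ t → t ≤ 1 →
    ‖∫ x, Complex.exp (Complex.I * (((b * x + a * (x ^ 2 - 1)) * t : ℝ) : ℂ)) ∂(gaussianReal 0 1)
      - Real.exp (-((b ^ 2 / 2 + a ^ 2) * t ^ 2))‖ ≤ K * t ^ 3 := by
  set γ := gaussianReal 0 1 with hγ
  have hi : ∀ n : ℕ, Integrable (fun x : ℝ => x ^ n) γ := integrable_pow_gaussianReal
  have hi1 : Integrable (fun x : ℝ => x) γ := by simpa using hi 1
  have hI3 : Integrable (fun x : ℝ => 4 * (B * |x| + A * (x ^ 2 + 1)) ^ 3) γ := by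
    have : ∀ x : ℝ, 4 * (B * |x| + A * (x ^ 2 + 1)) ^ 3 = 4 * (B ^ 3 * |x ^ 3| +
        3 * B ^ 2 * A * (x ^ 4 + x ^ 2) + 3 * B * A ^ 2 * (|x ^ 5| + 2 * |x ^ 3| + |x|)
        + A ^ 3 * (x ^ 6 + 3 * x ^ 4 + 3 * x ^ 2 + 1)) := by
      intro x
      have h2 : x ^ 2 = |x| ^ 2 := (sq_abs x).symm
      have h4 : x ^ 4 = |x| ^ 4 := (Even.pow_abs (by decide) x).symm
      have h6 : x ^ 6 = |x| ^ 6 := (Even.pow_abs (by decide) x).symm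
      rw [h2, h4, h6, abs_pow, abs_pow]; ring
    simp_rw [this]
    have a3 := (hi 3).abs
    have a5 := (hi 5).abs
    have a1 := hi1.abs
    have := hi 2
    have := hi 4
    have := hi 6
    fun_prop
  refine ⟨(∫ x, 4 * (B * |x| + A * (x ^ 2 + 1)) ^ 3 ∂γ) ⊔ 0 + (B ^ 2 / 2 + A ^ 2) ^ 2,
    by positivity, ?_⟩
  intro a b t ha hb ht ht1
  have hA : 0 ≤ A := (abs_nonneg a).trans ha
  have hB : 0 ≤ B := (abs_nonneg b).trans hb
  set ξ : ℝ → ℝ := fun x => (b * x + a * (x ^ 2 - 1)) * t with hξ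
  have hξe : ∀ x, ξ x = t * (b * x ^ 1 + a * (x ^ 2 - 1)) := by
    intro x; simp only [hξ]; ring
  have hξi : Integrable ξ γ := by
    have := hi 1
    have := hi 2
    refine Integrable.congr ?_ (ae_of_all _ fun x => (hξe x).symm)
    fun_prop
  have hξ2e : ∀ x, ξ x ^ 2 = t ^ 2 * (b ^ 2 * x ^ 2 + 2 * a * b * (x ^ 3 - x ^ 1)
      + a ^ 2 * (x ^ 4 - 2 * x ^ 2 + 1)) := by intro x; simp only [hξ]; ring
  have hξ2i : Integrable (fun x => ξ x ^ 2) γ := by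
    simp_rw [hξ2e]
    have := hi 1
    have := hi 2
    have := hi 3
    have := hi 4
    fun_prop
  have hm1 : ∫ x, ξ x ∂γ = 0 := by
    have := hi 1
    have := hi 2
    simp_rw [hξe]
    rw [integral_const_mul, integral_add (by fun_prop) (by fun_prop), integral_const_mul,
      integral_const_mul, integral_sub (by fun_prop) (by fun_prop), integral_pow_two_gaussianReal]
    simp [hγ, integral_id_gaussianReal]
  have hm2 : ∫ x, ξ x ^ 2 ∂γ = t ^ 2 * (b ^ 2 + 2 * a ^ 2) := by
    simp_rw [hξ2e]
    have := hi 1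
    have := hi 2
    have := hi 3
    have := hi 4
    rw [integral_const_mul, integral_add (by fun_prop) (by fun_prop),
      integral_add (by fun_prop) (by fun_prop), integral_const_mul, integral_const_mul,
      integral_const_mul, integral_sub (by fun_prop) (by fun_prop),
      integral_add (by fun_prop) (by fun_prop), integral_sub (by fun_prop) (by fun_prop),
      integral_const_mul, integral_pow_two_gaussianReal, integral_pow_three_gaussianReal,
      integral_pow_four_gaussianReal]
    rw [show ∫ x : ℝ, x ^ 1 ∂γ = 0 by simp [hγ, integral_id_gaussianReal]]
    simp; ring_nf; simp
  set y : ℝ := (b ^ 2 / 2 + a ^ 2) * t ^ 2 with hy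
  have hy0 : 0 ≤ y := by positivity
  have hexpi : Integrable (fun x => Complex.exp (Complex.I * ((ξ x : ℝ) : ℂ))) γ := by
    refine (integrable_const (1:ℝ)).mono' (by fun_prop) (ae_of_all _ fun x => ?_)
    rw [Complex.norm_exp_I_mul_ofReal]
  have hTi : Integrable (fun x => (1 + Complex.I * ((ξ x : ℝ) : ℂ) - ((ξ x : ℝ) : ℂ) ^ 2 / 2)) γ := by
    have : Integrable (fun x => ((ξ x : ℝ) : ℂ)) γ := hξi.ofReal
    have h2 : Integrable (fun x => ((ξ x : ℝ) : ℂ) ^ 2) γ := by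
      simpa using hξ2i.ofReal (𝕜 := ℂ)
    exact ((integrable_const _).add (this.const_mul _)).sub (h2.div_const _)
  have hT : ∫ x, (1 + Complex.I * ((ξ x : ℝ) : ℂ) - ((ξ x : ℝ) : ℂ) ^ 2 / 2) ∂γ
      = ((1 - y : ℝ) : ℂ) := by
    have : Integrable (fun x => ((ξ x : ℝ) : ℂ)) γ := hξi.ofReal
    have h2 : Integrable (fun x => ((ξ x : ℝ) : ℂ) ^ 2) γ := by
      simpa using hξ2i.ofReal (𝕜 := ℂ)
    have e2 : ∫ x, ((ξ x : ℝ) : ℂ) ^ 2 ∂γ = ((t ^ 2 * (b ^ 2 + 2 * a ^ 2) : ℝ) : ℂ) := by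
      rw [← hm2, ← integral_complex_ofReal]; push_cast; rfl
    have h1 : Integrable (fun x => 1 + Complex.I * ((ξ x : ℝ) : ℂ)) γ :=
      (integrable_const _).add (this.const_mul _)
    rw [integral_sub h1 (h2.div_const 2), integral_add (integrable_const _) (this.const_mul _), integral_const_mul, integral_div,
      e2, integral_complex_ofReal, hm1]
    simp [hy]; ring
  have hbd : ∀ x, 4 * |ξ x| ^ 3 ≤ t ^ 3 * (4 * (B * |x| + A * (x ^ 2 + 1)) ^ 3) := by
    intro x
    have h1 : |ξ x| ≤ t * (B * |x| + A * (x ^ 2 + 1)) := by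
      simp only [hξ, abs_mul, abs_of_nonneg ht]
      rw [mul_comm]
      refine mul_le_mul_of_nonneg_left ?_ ht
      refine (abs_add_le _ _).trans ?_
      rw [abs_mul, abs_mul]
      gcongr
      rw [abs_le]; constructor <;> nlinarith [sq_nonneg x]
    calc 4 * |ξ x| ^ 3 ≤ 4 * (t * (B * |x| + A * (x ^ 2 + 1))) ^ 3 := by gcongr
      _ = _ := by ring
  have h1 : ‖∫ x, Complex.exp (Complex.I * ((ξ x : ℝ) : ℂ)) ∂γ - ((1 - y : ℝ) : ℂ)‖
      ≤ t ^ 3 * ∫ x, 4 * (B * |x| + A * (x ^ 2 + 1)) ^ 3 ∂γ := by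
    rw [← hT, ← integral_sub hexpi hTi, ← integral_const_mul]
    refine norm_integral_le_of_norm_le (hI3.const_mul _) (ae_of_all _ fun x => ?_)
    exact (norm_cexp_I_mul_sub_taylor_two_le _).trans (hbd x)
  have h2 : ‖((1 - y : ℝ) : ℂ) - Real.exp (-y)‖ ≤ (B ^ 2 / 2 + A ^ 2) ^ 2 * t ^ 3 := by
    rw [← Complex.ofReal_sub, Complex.norm_real, Real.norm_eq_abs]
    refine (abs_exp_neg_sub_le hy0).trans ?_
    have ha2 : a ^ 2 ≤ A ^ 2 := by rw [← sq_abs]; gcongr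
    have hb2 : b ^ 2 ≤ B ^ 2 := by rw [← sq_abs]; gcongr
    calc y ^ 2 ≤ ((B ^ 2 / 2 + A ^ 2) * t ^ 2) ^ 2 := by simp only [hy]; gcongr
      _ = (B ^ 2 / 2 + A ^ 2) ^ 2 * (t ^ 3 * t) := by ring
      _ ≤ (B ^ 2 / 2 + A ^ 2) ^ 2 * (t ^ 3 * 1) := by gcongr
      _ = _ := by ring
  calc _ ≤ t ^ 3 * (∫ x, 4 * (B * |x| + A * (x ^ 2 + 1)) ^ 3 ∂γ)
        + (B ^ 2 / 2 + A ^ 2) ^ 2 * t ^ 3 := by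
        refine le_trans ?_ (add_le_add h1 h2)
        exact norm_sub_le_norm_sub_add_norm_sub _ _ _
    _ ≤ t ^ 3 * ((∫ x, 4 * (B * |x| + A * (x ^ 2 + 1)) ^ 3 ∂γ) ⊔ 0)
        + (B ^ 2 / 2 + A ^ 2) ^ 2 * t ^ 3 := by gcongr; exact le_max_left _ _
    _ = _ := by ring

/-- Multiplying by a factor whose conditional mean is close to one barely changes an expectation. -/
lemma norm_integral_mul_sub_integral_le {Ω : Type*} [MeasurableSpace Ω] {P : Measure Ω}
    [IsProbabilityMeasure P] {μ : Measure ℝ} [IsProbabilityMeasure μ] {M : Ω → ℂ} {a X : Ω → ℝ}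
    {g : ℝ → ℝ → ℂ} {A G L κ : ℝ} (hM : Measurable M) (ha : Measurable a) (hX : Measurable X)
    (hg : Measurable (Function.uncurry g)) (hML : ∀ ω, ‖M ω‖ ≤ L) (haA : ∀ ω, |a ω| ≤ A)
    (hgG : ∀ a x, |a| ≤ A → ‖g a x‖ ≤ G) (hgκ : ∀ a, |a| ≤ A → ‖∫ x, g a x ∂μ - 1‖ ≤ κ)
    (hXμ : P.map X = μ) (hind : IndepFun (fun ω => (M ω, a ω)) X P) :
    ‖∫ ω, M ω * g (a ω) (X ω) ∂P - ∫ ω, M ω ∂P‖ ≤ L * κ := by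
  have hMa : Measurable (fun ω => (M ω, a ω)) := hM.prodMk ha
  have hprod := (indepFun_iff_map_prod_eq_prod_map_map hMa.aemeasurable hX.aemeasurable).1 hind
  rw [hXμ] at hprod
  have hF : Measurable (fun q : (ℂ × ℝ) × ℝ => q.1.1 * g q.1.2 q.2) := by
    have : Measurable (fun q : (ℂ × ℝ) × ℝ => Function.uncurry g (q.1.2, q.2)) :=
      hg.comp (by fun_prop)
    exact (by fun_prop : Measurable (fun q : (ℂ × ℝ) × ℝ => q.1.1)).mul this
  have hint : Integrable (fun q : (ℂ × ℝ) × ℝ => q.1.1 * g q.1.2 q.2)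
      ((P.map (fun ω => (M ω, a ω))).prod μ) := by
    rw [← hprod, integrable_map_measure hF.aestronglyMeasurable (by fun_prop)]
    refine (integrable_const (L * G)).mono' (hF.comp (hMa.prodMk hX)).aestronglyMeasurable
      (ae_of_all _ fun ω => ?_)
    simp only [Function.comp, norm_mul]
    exact mul_le_mul (hML ω) (hgG _ _ (haA ω)) (norm_nonneg _) ((norm_nonneg _).trans (hML ω))
  have hI : StronglyMeasurable (fun q : ℂ × ℝ => ∫ x, g q.2 x ∂μ) := by
    refine StronglyMeasurable.integral_prod_right (f := fun (q : ℂ × ℝ) x => g q.2 x) ?_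
    exact (hg.comp (by fun_prop : Measurable (fun q : (ℂ × ℝ) × ℝ => (q.1.2, q.2)))).stronglyMeasurable
  have h1 : ∫ ω, M ω * g (a ω) (X ω) ∂P = ∫ ω, M ω * ∫ x, g (a ω) x ∂μ ∂P := by
    calc ∫ ω, M ω * g (a ω) (X ω) ∂P
        = ∫ q, q.1.1 * g q.1.2 q.2 ∂(P.map (fun ω => ((M ω, a ω), X ω))) := by
          rw [integral_map (hMa.prodMk hX).aemeasurable hF.aestronglyMeasurable]
      _ = ∫ p, ∫ x, p.1 * g p.2 x ∂μ ∂(P.map (fun ω => (M ω, a ω))) := by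
          rw [hprod, integral_prod _ hint]
      _ = ∫ p, p.1 * ∫ x, g p.2 x ∂μ ∂(P.map (fun ω => (M ω, a ω))) := by
          simp_rw [integral_const_mul]
      _ = _ := by
          rw [integral_map hMa.aemeasurable]
          exact (measurable_fst.mul hI.measurable).aestronglyMeasurable
  have hIa : Measurable (fun ω => ∫ x, g (a ω) x ∂μ) := hI.measurable.comp hMa
  have hG0 : ∀ ω, ‖∫ x, g (a ω) x ∂μ‖ ≤ G := fun ω => by
    have := norm_integral_le_of_norm_le_const (μ := μ) (ae_of_all _ fun x => hgG (a ω) x (haA ω))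
    simpa using this
  have hMi : Integrable M P := (integrable_const L).mono' hM.aestronglyMeasurable (ae_of_all _ hML)
  have hMg : Integrable (fun ω => M ω * ∫ x, g (a ω) x ∂μ) P := by
    refine (integrable_const (L * G)).mono' (hM.mul hIa).aestronglyMeasurable
      (ae_of_all _ fun ω => ?_)
    rw [norm_mul]
    exact mul_le_mul (hML ω) (hG0 ω) (norm_nonneg _) ((norm_nonneg _).trans (hML ω))
  rw [h1, ← integral_sub hMg hMi]
  have := norm_integral_le_of_norm_le_const (μ := P) (C := L * κ)
    (f := fun ω => M ω * ∫ x, g (a ω) x ∂μ - M ω) (ae_of_all _ fun ω => by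
      rw [← mul_sub_one, norm_mul]
      exact mul_le_mul (hML ω) (hgκ _ (haA ω)) (norm_nonneg _) ((norm_nonneg _).trans (hML ω)))
  simpa using this

/-- Telescoping version of `norm_integral_mul_sub_integral_le`. -/
lemma norm_integral_prod_sub_one_le {Ω : Type*} [MeasurableSpace Ω] {P : Measure Ω}
    [IsProbabilityMeasure P] {μ : Measure ℝ} [IsProbabilityMeasure μ] {a X : ℕ → Ω → ℝ}
    {g : ℕ → ℝ → ℝ → ℂ} {A G κ : ℝ} (N : ℕ) (ha : ∀ k, Measurable (a k))
    (hX : ∀ k, Measurable (X k)) (hg : ∀ k, Measurable (Function.uncurry (g k)))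
    (haA : ∀ k ω, |a k ω| ≤ A) (hG : 1 ≤ G) (hgG : ∀ k a x, |a| ≤ A → ‖g k a x‖ ≤ G)
    (hgκ : ∀ k a, |a| ≤ A → ‖∫ x, g k a x ∂μ - 1‖ ≤ κ)
    (hXμ : ∀ k < N, P.map (X k) = μ)
    (hind : ∀ k < N, IndepFun
      (fun ω => (∏ l ∈ Finset.range k, g l (a l ω) (X l ω), a k ω)) (X k) P) :
    ‖∫ ω, ∏ l ∈ Finset.range N, g l (a l ω) (X l ω) ∂P - 1‖ ≤ N * (G ^ N * κ) := by
  have hκ : 0 ≤ κ := (norm_nonneg _).trans (hgκ 0 (a 0 (Classical.choice P.nonempty_of_neZero)) (haA _ _))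
  suffices H : ∀ n ≤ N, ‖∫ ω, ∏ l ∈ Finset.range n, g l (a l ω) (X l ω) ∂P - 1‖
      ≤ n * (G ^ N * κ) from H N le_rfl
  intro n hn
  induction n with
  | zero => simp
  | succ n ih =>
    have hstep := norm_integral_mul_sub_integral_le (P := P) (μ := μ)
      (M := fun ω => ∏ l ∈ Finset.range n, g l (a l ω) (X l ω)) (a := a n) (X := X n) (g := g n)
      (A := A) (G := G) (L := G ^ N) (κ := κ)
      (Finset.measurable_fun_prod _ fun l _ => (hg l).comp ((ha l).prodMk (hX l)))
      (ha n) (hX n) (hg n)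
      (fun ω => by
        rw [norm_prod]
        calc _ ≤ ∏ l ∈ Finset.range n, G :=
              Finset.prod_le_prod (fun _ _ => norm_nonneg _) fun l _ => hgG _ _ _ (haA _ _)
          _ = G ^ n := by simp
          _ ≤ G ^ N := pow_le_pow_right₀ hG (by omega))
      (haA n) (hgG n) (hgκ n) (hXμ n (by omega)) (hind n (by omega))
    simp_rw [Finset.prod_range_succ]
    have := norm_sub_le_norm_sub_add_norm_sub
      (∫ ω, (∏ l ∈ Finset.range n, g l (a l ω) (X l ω)) * g n (a n ω) (X n ω) ∂P)
      (∫ ω, ∏ l ∈ Finset.range n, g l (a l ω) (X l ω) ∂P) 1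
    push_cast
    linarith [ih (by omega)]

lemma prod_range_mul_div_mod {M : Type*} [CommMonoid M] (F : ℕ → ℕ → M) (m n : ℕ) :
    ∏ k ∈ Finset.range (m * n), F (k / n) (k % n)
      = ∏ i ∈ Finset.range m, ∏ j ∈ Finset.range n, F i j := by
  induction m with
  | zero => simp
  | succ m ih =>
    rw [add_mul, one_mul, Finset.prod_range_add, ih, Finset.prod_range_succ]
    congr 1
    refine Finset.prod_congr rfl fun j hj => ?_
    have hj := Finset.mem_range.1 hj
    have hn : 0 < n := by omega
    rw [mul_comm m n, Nat.mul_add_div hn, Nat.mul_add_mod, Nat.mod_eq_of_lt hj,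
      Nat.div_eq_of_lt hj, add_zero]

namespace IsBrownianSheet

variable {Ω : Type*} [MeasurableSpace Ω] {P : Measure Ω} {W : ℝ × ℝ → Ω → ℝ}

lemma map_sum_eq (hW : IsBrownianSheet P W) {ι : Type*} [Fintype ι] (p : ι → ℝ × ℝ)
    (hp : ∀ i, p i ∈ Set.Icc ((0:ℝ), (0:ℝ)) (1, 1)) (c : ι → ℝ) :
    P.map (fun ω => ∑ i, c i * W (p i) ω) = gaussianReal 0 (Real.toNNReal (∑ i, ∑ j, c i * c j *
      (min (p i).1 (p j).1 * min (p i).2 (p j).2))) := by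
  let e := Fintype.equivFin ι
  have h := hW.2.2 (Fintype.card ι) (p ∘ e.symm) (fun k => hp _) (c ∘ e.symm)
  simp only [Function.comp] at h
  have h1 : ∀ ω, ∑ k, c (e.symm k) * W (p (e.symm k)) ω = ∑ i, c i * W (p i) ω := fun ω =>
    Equiv.sum_comp e.symm (fun i => c i * W (p i) ω)
  simp_rw [h1] at h
  rw [h]
  congr 2
  rw [← Equiv.sum_comp e.symm]
  exact Finset.sum_congr rfl fun i _ => Equiv.sum_comp e.symm
    (fun j => c (e.symm i) * c j * (min (p (e.symm i)).1 (p j).1 * min (p (e.symm i)).2 (p j).2))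

lemma hasGaussianLaw (hW : IsBrownianSheet P W) {ι : Type*} [Fintype ι] (p : ι → ℝ × ℝ)
    (hp : ∀ i, p i ∈ Set.Icc ((0:ℝ), (0:ℝ)) (1, 1)) :
    HasGaussianLaw (fun ω i => W (p i) ω) P := by
  classical
  have hm : Measurable (fun ω i => W (p i) ω) := measurable_pi_lambda _ fun i => hW.1 _
  refine ⟨isGaussian_of_map_eq_gaussianReal fun L =>
    ⟨0, _, Eq.trans ?_ (hW.map_sum_eq p hp (fun i => L (Pi.single i 1)))⟩⟩
  rw [Measure.map_map (by fun_prop) hm]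
  congr 1
  ext ω
  simp only [Function.comp]
  conv_lhs => rw [← ContinuousLinearMap.coe_coe, LinearMap.pi_apply_eq_sum_univ L.toLinearMap]
  refine Finset.sum_congr rfl fun i _ => ?_
  have : (fun j => if i = j then (1 : ℝ) else 0) = Pi.single i 1 := by
    ext j
    simp [Pi.single_apply, eq_comm]
  simp [mul_comm, this]

lemma map_eq (hW : IsBrownianSheet P W) {p : ℝ × ℝ} (hp : p ∈ Set.Icc ((0:ℝ), (0:ℝ)) (1, 1)) :
    P.map (W p) = gaussianReal 0 (Real.toNNReal (p.1 * p.2)) := by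
  simpa using hW.map_sum_eq (fun _ : Unit => p) (fun _ => hp) (fun _ => 1)

lemma variance_sum (hW : IsBrownianSheet P W) {ι : Type*} [Fintype ι] (p : ι → ℝ × ℝ)
    (hp : ∀ i, p i ∈ Set.Icc ((0:ℝ), (0:ℝ)) (1, 1)) (c : ι → ℝ) :
    Var[fun ω => ∑ i, c i * W (p i) ω; P] = (∑ i, ∑ j, c i * c j *
      (min (p i).1 (p j).1 * min (p i).2 (p j).2)) ⊔ 0 := by
  have hm : Measurable (fun ω => ∑ i, c i * W (p i) ω) :=
    Finset.measurable_fun_sum _ fun i _ => (hW.1 _).const_mul _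
  have := variance_id_map hm.aemeasurable (μ := P)
  rw [← this, hW.map_sum_eq p hp c, variance_id_gaussianReal, Real.coe_toNNReal']

lemma memLp_two (hW : IsBrownianSheet P W) {p : ℝ × ℝ}
    (hp : p ∈ Set.Icc ((0:ℝ), (0:ℝ)) (1, 1)) : MemLp (W p) 2 P :=
  ((hW.hasGaussianLaw (fun _ : Unit => p) fun _ => hp).eval ()).memLp_two

lemma covariance_eq (hW : IsBrownianSheet P W) [IsProbabilityMeasure P] {p q : ℝ × ℝ}
    (hp : p ∈ Set.Icc ((0:ℝ), (0:ℝ)) (1, 1)) (hq : q ∈ Set.Icc ((0:ℝ), (0:ℝ)) (1, 1)) :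
    cov[W p, W q; P] = min p.1 q.1 * min p.2 q.2 := by
  have h1 := hW.variance_sum (fun _ : Unit => p) (fun _ => hp) (fun _ => 1)
  have h2 := hW.variance_sum (fun _ : Unit => q) (fun _ => hq) (fun _ => 1)
  have h3 := hW.variance_sum ![p, q] (by intro i; fin_cases i <;> simpa) (fun _ => 1)
  have p1 : 0 ≤ p.1 := hp.1.1
  have p2 : 0 ≤ p.2 := hp.1.2
  have q1 : 0 ≤ q.1 := hq.1.1
  have q2 : 0 ≤ q.2 := hq.1.2
  simp only [Fin.sum_univ_two, one_mul, Matrix.cons_val_zero, Matrix.cons_val_one, min_self,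
    Finset.univ_unique, Finset.sum_const, Finset.card_singleton, one_smul] at h1 h2 h3
  rw [max_eq_left (by positivity)] at h1 h2 h3
  have h4 := variance_fun_add (hW.memLp_two hp) (hW.memLp_two hq)
  rw [min_comm q.1, min_comm q.2] at h3
  change Var[W p; P] = _ at h1
  change Var[W q; P] = _ at h2
  linarith

end IsBrownianSheet

/-- The increment of `W` over the `(i, j)`-th cell of the grid of mesh `1 / n`, normalized. -/
noncomputable def cellIncrement {Ω : Type*} (W : ℝ × ℝ → Ω → ℝ) (n i j : ℕ) (ω : Ω) : ℝ :=
  n * (W ((i : ℝ) / n, (j : ℝ) / n) ω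
    + W (((i + 1 : ℕ) : ℝ) / n, ((j + 1 : ℕ) : ℝ) / n) ω
    - W ((i : ℝ) / n, ((j + 1 : ℕ) : ℝ) / n) ω
    - W (((i + 1 : ℕ) : ℝ) / n, (j : ℝ) / n) ω)

lemma grid_mem_Icc {n i j : ℕ} (hi : i ≤ n) (hj : j ≤ n) :
    ((i : ℝ) / n, (j : ℝ) / n) ∈ Set.Icc ((0:ℝ), (0:ℝ)) (1, 1) :=
  ⟨⟨by positivity, by positivity⟩, ⟨div_le_one_of_le₀ (by exact_mod_cast hi) (by positivity),
    div_le_one_of_le₀ (by exact_mod_cast hj) (by positivity)⟩⟩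

namespace IsBrownianSheet

variable {Ω : Type*} [MeasurableSpace Ω] {P : Measure Ω} {W : ℝ × ℝ → Ω → ℝ}

lemma map_cellIncrement (hW : IsBrownianSheet P W) {n i j : ℕ} (hi : i < n) (hj : j < n) :
    P.map (cellIncrement W n i j) = gaussianReal 0 1 := by
  have hn : (0:ℝ) < n := by exact_mod_cast (by omega : 0 < n)
  have h := hW.map_sum_eq ![((i : ℝ) / n, (j : ℝ) / n),
    (((i + 1 : ℕ) : ℝ) / n, ((j + 1 : ℕ) : ℝ) / n), ((i : ℝ) / n, ((j + 1 : ℕ) : ℝ) / n),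
    (((i + 1 : ℕ) : ℝ) / n, (j : ℝ) / n)] (by
      intro k
      fin_cases k
      · exact grid_mem_Icc hi.le hj.le
      · exact grid_mem_Icc hi hj
      · exact grid_mem_Icc hi.le hj
      · exact grid_mem_Icc hi hj.le) ![(n : ℝ), n, -n, -n]
  have e : (cellIncrement W n i j) = fun ω => ∑ k, (![(n : ℝ), n, -n, -n] : Fin 4 → ℝ) k *
      W ((![((i : ℝ) / n, (j : ℝ) / n),
    (((i + 1 : ℕ) : ℝ) / n, ((j + 1 : ℕ) : ℝ) / n), ((i : ℝ) / n, ((j + 1 : ℕ) : ℝ) / n),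
    (((i + 1 : ℕ) : ℝ) / n, (j : ℝ) / n)] : Fin 4 → ℝ × ℝ) k) ω := by
    ext ω
    simp only [Fin.sum_univ_four, Matrix.cons_val, cellIncrement]
    ring
  rw [e, h]
  congr 1
  have hii : (i : ℝ) / n ≤ ((i + 1 : ℕ) : ℝ) / n := by gcongr; simp
  have hjj : (j : ℝ) / n ≤ ((j + 1 : ℕ) : ℝ) / n := by gcongr; simp
  simp only [Fin.sum_univ_four, Matrix.cons_val, min_self, min_eq_left hii, min_eq_left hjj,
    min_eq_right hii, min_eq_right hjj]
  rw [← Real.toNNReal_one]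
  congr 1
  push_cast
  field_simp
  ring

/-- An increment over a cell is independent of the values of `W` at the grid points which are not
strictly to the upper right of the lower left corner of the cell. -/
lemma indep_cellIncrement (hW : IsBrownianSheet P W) [IsProbabilityMeasure P] {n i j : ℕ}
    (hi : i < n) (hj : j < n) (S : Finset (ℕ × ℕ))
    (hS : ∀ q ∈ S, q.1 ≤ n ∧ q.2 ≤ n ∧ (q.1 ≤ i ∨ q.2 ≤ j)) :
    IndepFun (fun ω (q : S) => W ((q.1.1 : ℝ) / n, (q.1.2 : ℝ) / n) ω)
      (cellIncrement W n i j) P := by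
  classical
  have hn : (0:ℝ) < n := by exact_mod_cast (by omega : 0 < n)
  let T : Finset (ℕ × ℕ) := S ∪ {(i, j), (i + 1, j + 1), (i, j + 1), (i + 1, j)}
  have hT : ∀ q ∈ T, q.1 ≤ n ∧ q.2 ≤ n := by
    intro q hq
    simp only [T, Finset.mem_union, Finset.mem_insert, Finset.mem_singleton] at hq
    rcases hq with h | rfl | rfl | rfl | rfl
    · exact ⟨(hS q h).1, (hS q h).2.1⟩
    all_goals (constructor <;> simp only <;> omega)
  have hmem : ∀ q ∈ S, q ∈ T := fun q hq => Finset.mem_union_left _ hq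
  have h00 : (i, j) ∈ T := by simp [T]
  have h11 : (i + 1, j + 1) ∈ T := by simp [T]
  have h01 : (i, j + 1) ∈ T := by simp [T]
  have h10 : (i + 1, j) ∈ T := by simp [T]
  have hg := hW.hasGaussianLaw (fun q : T => ((q.1.1 : ℝ) / n, (q.1.2 : ℝ) / n))
    (fun q => grid_mem_Icc (hT q.1 q.2).1 (hT q.1 q.2).2)
  let pr : T → ((T → ℝ) →L[ℝ] ℝ) := fun q => ContinuousLinearMap.proj (R := ℝ) (φ := fun _ => ℝ) q
  let L : (T → ℝ) →L[ℝ] (S → ℝ) × (Unit → ℝ) :=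
    (ContinuousLinearMap.pi fun q : S => pr ⟨q.1, hmem _ q.2⟩).prod
      (ContinuousLinearMap.pi fun _ : Unit =>
        (n : ℝ) • (pr ⟨_, h00⟩ + pr ⟨_, h11⟩ - pr ⟨_, h01⟩ - pr ⟨_, h10⟩))
  have hgL := hg.map_fun L
  have hind := HasGaussianLaw.indepFun_of_covariance_eval
    (X := fun (q : S) ω => W ((q.1.1 : ℝ) / n, (q.1.2 : ℝ) / n) ω)
    (Y := fun (_ : Unit) ω => cellIncrement W n i j ω) (P := P) ?_ ?_
  · exact hind.comp (φ := id) (ψ := fun y : Unit → ℝ => y ()) measurable_id (by fun_prop)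
  · exact hgL
  · intro q _
    obtain ⟨hq1, hq2, hq⟩ := hS q.1 q.2
    have mq := hW.memLp_two (grid_mem_Icc hq1 hq2)
    have m00 := hW.memLp_two (grid_mem_Icc hi.le hj.le)
    have m11 := hW.memLp_two (grid_mem_Icc (n := n) (i := i + 1) (j := j + 1) hi hj)
    have m01 := hW.memLp_two (grid_mem_Icc (n := n) (i := i) (j := j + 1) hi.le hj)
    have m10 := hW.memLp_two (grid_mem_Icc (n := n) (i := i + 1) (j := j) hi hj.le)
    have e : (fun ω => cellIncrement W n i j ω) = fun ω => (n : ℝ) *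
      (W ((i : ℝ) / n, (j : ℝ) / n) + W (((i + 1 : ℕ) : ℝ) / n, ((j + 1 : ℕ) : ℝ) / n)
      - W ((i : ℝ) / n, ((j + 1 : ℕ) : ℝ) / n) - W (((i + 1 : ℕ) : ℝ) / n, (j : ℝ) / n)) ω := rfl
    rw [e, covariance_const_mul_right,
      covariance_sub_right mq ((m00.add m11).sub m01) m10, covariance_sub_right mq (m00.add m11) m01,
      covariance_add_right mq m00 m11,
      hW.covariance_eq (grid_mem_Icc hq1 hq2) (grid_mem_Icc hi.le hj.le),
      hW.covariance_eq (grid_mem_Icc hq1 hq2) (grid_mem_Icc (n := n) (i := i + 1) (j := j + 1) hi hj),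
      hW.covariance_eq (grid_mem_Icc hq1 hq2) (grid_mem_Icc (n := n) (i := i) (j := j + 1) hi.le hj),
      hW.covariance_eq (grid_mem_Icc hq1 hq2) (grid_mem_Icc (n := n) (i := i + 1) (j := j) hi hj.le)]
    simp only
    rcases hq with hq | hq
    · have a1 : (q.1.1 : ℝ) / n ≤ (i : ℝ) / n := by gcongr
      have a2 : (q.1.1 : ℝ) / n ≤ ((i + 1 : ℕ) : ℝ) / n := by gcongr; omega
      rw [min_eq_left a1, min_eq_left a2]; ring
    · have a1 : (q.1.2 : ℝ) / n ≤ (j : ℝ) / n := by gcongr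
      have a2 : (q.1.2 : ℝ) / n ≤ ((j + 1 : ℕ) : ℝ) / n := by gcongr; omega
      rw [min_eq_left a1, min_eq_left a2]; ring

end IsBrownianSheet

lemma measurable_cellIncrement {Ω : Type*} [MeasurableSpace Ω] {W : ℝ × ℝ → Ω → ℝ} {n i j : ℕ}
    (h00 : Measurable (W ((i : ℝ) / n, (j : ℝ) / n)))
    (h11 : Measurable (W (((i + 1 : ℕ) : ℝ) / n, ((j + 1 : ℕ) : ℝ) / n)))
    (h01 : Measurable (W ((i : ℝ) / n, ((j + 1 : ℕ) : ℝ) / n)))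
    (h10 : Measurable (W (((i + 1 : ℕ) : ℝ) / n, (j : ℝ) / n))) :
    Measurable (cellIncrement W n i j) :=
  (((h00.add h11).sub h01).sub h10).const_mul _

/-- Products of functionals of the cells preceding the `k`-th one (in lexicographic order) are
measurable with respect to the values of `W` which are not to the upper right of that cell. -/
lemma measurable_prod_cells {Ω : Type*} [MeasurableSpace Ω] {W : ℝ × ℝ → Ω → ℝ} {n k : ℕ}
    (hk : k < n * n)
    (hWm : ∀ p q : ℕ, p ≤ n → q ≤ n → (p ≤ k / n ∨ q ≤ k % n) →
      Measurable (W ((p : ℝ) / n, (q : ℝ) / n)))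
    {F : ℕ → ℕ → ℝ → ℝ} (hF : ∀ i j, Measurable (F i j)) {g : ℕ → ℝ → ℝ → ℂ}
    (hg : ∀ k, Measurable (Function.uncurry (g k))) :
    Measurable (fun ω => (∏ l ∈ Finset.range k,
      g l (F (l / n) (l % n) (W (((l / n : ℕ) : ℝ) / n, ((l % n : ℕ) : ℝ) / n) ω))
        (cellIncrement W n (l / n) (l % n) ω),
      F (k / n) (k % n) (W (((k / n : ℕ) : ℝ) / n, ((k % n : ℕ) : ℝ) / n) ω))) := by
  have hn : 0 < n := by
    by_contra h
    simp_all
  have hk1 : k / n < n := Nat.div_lt_of_lt_mul hk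
  have hk2 : k % n < n := Nat.mod_lt _ hn
  refine Measurable.prodMk (Finset.measurable_fun_prod _ fun l hl => ?_)
    ((hF _ _).comp (hWm _ _ hk1.le hk2.le (Or.inl le_rfl)))
  have hl := Finset.mem_range.1 hl
  have hl1 : l / n ≤ k / n := Nat.div_le_div_right hl.le
  have hl2 : l % n < n := Nat.mod_lt _ hn
  have hl3 : l / n + 1 ≤ k / n ∨ l % n + 1 ≤ k % n := by
    by_contra! h
    have e : l / n = k / n := by omega
    have e1 := Nat.div_add_mod l n
    have e2 := Nat.div_add_mod k n
    rw [e] at e1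
    omega
  refine (hg l).comp (((hF _ _).comp (hWm _ _ (by omega) hl2.le (Or.inl hl1))).prodMk
    (measurable_cellIncrement (hWm _ _ ?_ ?_ ?_) (hWm _ _ ?_ ?_ ?_) (hWm _ _ ?_ ?_ ?_)
      (hWm _ _ ?_ ?_ ?_)))
  all_goals omega

namespace IsBrownianSheet

variable {Ω : Type*} [MeasurableSpace Ω] {P : Measure Ω} {W : ℝ × ℝ → Ω → ℝ}

lemma indepFun_prod_cells (hW : IsBrownianSheet P W) [IsProbabilityMeasure P] {n k : ℕ}
    (hk : k < n * n) {F : ℕ → ℕ → ℝ → ℝ} (hF : ∀ i j, Measurable (F i j)) {g : ℕ → ℝ → ℝ → ℂ}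
    (hg : ∀ k, Measurable (Function.uncurry (g k))) :
    IndepFun (fun ω => (∏ l ∈ Finset.range k,
      g l (F (l / n) (l % n) (W (((l / n : ℕ) : ℝ) / n, ((l % n : ℕ) : ℝ) / n) ω))
        (cellIncrement W n (l / n) (l % n) ω),
      F (k / n) (k % n) (W (((k / n : ℕ) : ℝ) / n, ((k % n : ℕ) : ℝ) / n) ω)))
      (cellIncrement W n (k / n) (k % n)) P := by
  have hn : 0 < n := by
    by_contra h
    simp_all
  have hk1 : k / n < n := Nat.div_lt_of_lt_mul hk
  have hk2 : k % n < n := Nat.mod_lt _ hn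
  let S : Finset (ℕ × ℕ) := (Finset.range (n + 1) ×ˢ Finset.range (n + 1)).filter
    fun q => q.1 ≤ k / n ∨ q.2 ≤ k % n
  have hS : ∀ q : ℕ × ℕ, q ∈ S ↔ q.1 ≤ n ∧ q.2 ≤ n ∧ (q.1 ≤ k / n ∨ q.2 ≤ k % n) := by
    intro q
    simp only [S, Finset.mem_filter, Finset.mem_product, Finset.mem_range, Nat.lt_succ_iff,
      and_assoc]
  have h := hW.indep_cellIncrement hk1 hk2 S fun q hq => (hS q).1 hq
  rw [IndepFun_iff_Indep] at h ⊢
  refine indep_of_indep_of_le_left h (Measurable.comap_le ?_)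
  refine @measurable_prod_cells Ω (MeasurableSpace.comap _ _) W n k hk ?_ F hF g hg
  intro p q hp hq hpq
  exact (measurable_pi_apply (X := fun _ : S => ℝ)
    (⟨(p, q), (hS _).2 ⟨hp, hq, hpq⟩⟩ : S)).comp (comap_measurable _)

/-- The exponential functional of the increments compensated by its conditional means has an
expectation close to one. -/
lemma exists_norm_integral_prod_cexp_sub_one_le (hW : IsBrownianSheet P W) [IsProbabilityMeasure P]
    {f : ℝ → ℝ} (hf : Measurable f) {C : ℝ} (hfC : ∀ x, |f x| ≤ C) (A B : ℝ) :
    ∃ K, ∀ n : ℕ, 1 ≤ n → ∀ b c : ℕ → ℕ → ℝ, (∀ i j, |b i j| ≤ B) → (∀ i j, |c i j| ≤ A) →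
      ‖∫ ω, ∏ i ∈ Finset.range n, ∏ j ∈ Finset.range n,
        (Complex.exp (Complex.I * (((b i j * cellIncrement W n i j ω
          + c i j * f (W ((i : ℝ) / n, (j : ℝ) / n) ω) * (cellIncrement W n i j ω ^ 2 - 1))
            * (1 / n) : ℝ) : ℂ)) *
          (Real.exp ((b i j ^ 2 / 2 + (c i j * f (W ((i : ℝ) / n, (j : ℝ) / n) ω)) ^ 2)
            * (1 / n) ^ 2) : ℂ)) ∂P - 1‖ ≤ K / n := by
  obtain ⟨K, hK0, hK⟩ := exists_norm_integral_cexp_gaussianReal_sub_le (A * C) B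
  set Y : ℝ := B ^ 2 / 2 + (A * C) ^ 2 with hY
  have hY0 : 0 ≤ Y := by positivity
  refine ⟨K * Real.exp Y ^ 2, fun n hn b c hb hc => ?_⟩
  have hn0 : (0 : ℝ) < n := by exact_mod_cast hn
  have ht0 : (0 : ℝ) ≤ 1 / n := by positivity
  have ht1 : (1 : ℝ) / n ≤ 1 := div_le_one_of_le₀ (by exact_mod_cast hn) hn0.le
  let g : ℕ → ℝ → ℝ → ℂ := fun k a x =>
    Complex.exp (Complex.I * (((b (k / n) (k % n) * x + a * (x ^ 2 - 1)) * (1 / n) : ℝ) : ℂ)) *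
      (Real.exp ((b (k / n) (k % n) ^ 2 / 2 + a ^ 2) * (1 / n) ^ 2) : ℂ)
  let F : ℕ → ℕ → ℝ → ℝ := fun i j x => c i j * f x
  have hF : ∀ i j, Measurable (F i j) := fun i j => hf.const_mul _
  have hg : ∀ k, Measurable (Function.uncurry (g k)) := fun k => by
    simp only [g, Function.uncurry_def]
    fun_prop
  have hFA : ∀ i j x, |F i j x| ≤ A * C := fun i j x => by
    simp only [F, abs_mul]
    exact mul_le_mul (hc i j) (hfC x) (abs_nonneg _) ((abs_nonneg _).trans (hc i j))
  have hexp : ∀ k a, |a| ≤ A * C →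
      Real.exp ((b (k / n) (k % n) ^ 2 / 2 + a ^ 2) * (1 / n) ^ 2) ≤ Real.exp (Y * (1 / n) ^ 2) := by
    intro k a ha
    have h1 := sq_le_sq' (abs_le.1 (hb (k / n) (k % n))).1 (abs_le.1 (hb (k / n) (k % n))).2
    have h2 := sq_le_sq' (abs_le.1 ha).1 (abs_le.1 ha).2
    gcongr
    linarith
  have hexp1 : Real.exp (Y * (1 / n) ^ 2) ≤ Real.exp Y := by
    refine Real.exp_le_exp.2 (mul_le_of_le_one_right hY0 (pow_le_one₀ ht0 ht1))
  have hnorm : ∀ x : ℝ, ‖Complex.exp (Complex.I * (x : ℂ))‖ = 1 := fun x => by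
    rw [mul_comm]; exact Complex.norm_exp_ofReal_mul_I x
  have hWm := fun p : ℝ × ℝ => hW.1 p
  have key := norm_integral_prod_sub_one_le (P := P) (μ := gaussianReal 0 1)
    (a := fun k ω => F (k / n) (k % n) (W (((k / n : ℕ) : ℝ) / n, ((k % n : ℕ) : ℝ) / n) ω))
    (X := fun k => cellIncrement W n (k / n) (k % n)) (g := g)
    (A := A * C) (G := Real.exp (Y * (1 / n) ^ 2)) (κ := K * (1 / n) ^ 3 * Real.exp Y) (n * n)
    (fun k => (hF _ _).comp (hW.1 _))
    (fun k => measurable_cellIncrement (hW.1 _) (hW.1 _) (hW.1 _) (hW.1 _)) hg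
    (fun k ω => hFA _ _ _) (Real.one_le_exp (by positivity))
    (fun k a x ha => by
      simp only [g, norm_mul, hnorm, one_mul, Complex.norm_real, Real.norm_eq_abs, Real.abs_exp]
      exact hexp k a ha)
    (fun k a ha => by
      have h := hK a (b (k / n) (k % n)) (1 / n) ha (hb _ _) ht0 ht1
      set y : ℝ := (b (k / n) (k % n) ^ 2 / 2 + a ^ 2) * (1 / n) ^ 2 with hy
      have e : ∫ x, g k a x ∂(gaussianReal 0 1) - 1 =
          (∫ x, Complex.exp (Complex.I *
            (((b (k / n) (k % n) * x + a * (x ^ 2 - 1)) * (1 / n) : ℝ) : ℂ)) ∂(gaussianReal 0 1)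
            - (Real.exp (-y) : ℂ)) * (Real.exp y : ℂ) := by
        simp only [g]
        rw [integral_mul_const, sub_mul, ← Complex.ofReal_mul, ← Real.exp_add, neg_add_cancel,
          Real.exp_zero, Complex.ofReal_one]
      rw [e, norm_mul, Complex.norm_real, Real.norm_eq_abs, Real.abs_exp]
      exact mul_le_mul h ((hexp k a ha).trans hexp1) (Real.exp_nonneg _) (by positivity))
    (fun k hk => hW.map_cellIncrement (Nat.div_lt_of_lt_mul hk) (Nat.mod_lt _ hn))
    (fun k hk => hW.indepFun_prod_cells hk hF hg)
  have e : ∀ ω, _ = _ := fun ω => prod_range_mul_div_mod (fun i j =>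
    (Complex.exp (Complex.I * (((b i j * cellIncrement W n i j ω
          + c i j * f (W ((i : ℝ) / n, (j : ℝ) / n) ω) * (cellIncrement W n i j ω ^ 2 - 1))
            * (1 / n) : ℝ) : ℂ)) *
          (Real.exp ((b i j ^ 2 / 2 + (c i j * f (W ((i : ℝ) / n, (j : ℝ) / n) ω)) ^ 2)
            * (1 / n) ^ 2) : ℂ))) n n
  simp_rw [← e]
  refine key.trans (le_of_eq ?_)
  rw [← Real.exp_nat_mul]
  have : ((n * n : ℕ) : ℝ) * (Y * (1 / n) ^ 2) = Y := by
    push_cast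
    field_simp
  rw [this]
  push_cast
  field_simp

end IsBrownianSheet

lemma norm_cexp_I_mul_ofReal (x : ℝ) : ‖Complex.exp (Complex.I * (x : ℂ))‖ = 1 := by
  rw [mul_comm]; exact Complex.norm_exp_ofReal_mul_I x

lemma prod_prod_cexp_mul_exp (s t : Finset ℕ) (x y : ℕ → ℕ → ℝ) :
    ∏ i ∈ s, ∏ j ∈ t, (Complex.exp (Complex.I * (x i j : ℂ)) * (Real.exp (y i j) : ℂ)) =
      Complex.exp (Complex.I * ((∑ i ∈ s, ∑ j ∈ t, x i j : ℝ) : ℂ)) *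
        (Real.exp (∑ i ∈ s, ∑ j ∈ t, y i j) : ℂ) := by
  simp_rw [Finset.prod_mul_distrib, Complex.ofReal_exp, Complex.ofReal_sum, Finset.mul_sum,
    Complex.exp_sum]

namespace IsBrownianSheet

variable {Ω : Type*} [MeasurableSpace Ω] {P : Measure Ω} {W : ℝ × ℝ → Ω → ℝ}

lemma exists_norm_integral_cexp_mul_sub_one_le (hW : IsBrownianSheet P W) [IsProbabilityMeasure P]
    {f : ℝ → ℝ} (hf : Measurable f) {C : ℝ} (hfC : ∀ x, |f x| ≤ C) (A B : ℝ) :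
    ∃ K, ∀ n : ℕ, 1 ≤ n → ∀ b c : ℕ → ℕ → ℝ, (∀ i j, |b i j| ≤ B) → (∀ i j, |c i j| ≤ A) →
      ‖∫ ω, Complex.exp (Complex.I * ((∑ i ∈ Finset.range n, ∑ j ∈ Finset.range n,
          b i j * (cellIncrement W n i j ω * (1 / n)) : ℝ) : ℂ)) *
        (Complex.exp (Complex.I * ((∑ i ∈ Finset.range n, ∑ j ∈ Finset.range n,
          c i j * (f (W ((i : ℝ) / n, (j : ℝ) / n) ω) * (cellIncrement W n i j ω ^ 2 - 1)
            * (1 / n)) : ℝ) : ℂ)) *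
          (Real.exp (∑ i ∈ Finset.range n, ∑ j ∈ Finset.range n,
            c i j ^ 2 * (f (W ((i : ℝ) / n, (j : ℝ) / n) ω) ^ 2 * (1 / n) ^ 2)) : ℂ) - 1) ∂P‖
        ≤ K / n := by
  obtain ⟨K, hK⟩ := hW.exists_norm_integral_prod_cexp_sub_one_le hf hfC A B
  refine ⟨K + K, fun n hn b c hb hc => ?_⟩
  have h1 := hK n hn b c hb hc
  have h0 := hK n hn b (fun _ _ => 0) hb (fun i j => by simpa using (abs_nonneg _).trans (hc i j))
  simp_rw [prod_prod_cexp_mul_exp] at h0 h1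
  set β : ℝ := ∑ i ∈ Finset.range n, ∑ j ∈ Finset.range n, b i j ^ 2 / 2 * (1 / n) ^ 2 with hβ
  set SB : Ω → ℝ := fun ω => ∑ i ∈ Finset.range n, ∑ j ∈ Finset.range n,
          b i j * (cellIncrement W n i j ω * (1 / n)) with hSB
  set SY : Ω → ℝ := fun ω => ∑ i ∈ Finset.range n, ∑ j ∈ Finset.range n,
          c i j * (f (W ((i : ℝ) / n, (j : ℝ) / n) ω) * (cellIncrement W n i j ω ^ 2 - 1)
            * (1 / n)) with hSY
  set SV : Ω → ℝ := fun ω => ∑ i ∈ Finset.range n, ∑ j ∈ Finset.range n,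
            c i j ^ 2 * (f (W ((i : ℝ) / n, (j : ℝ) / n) ω) ^ 2 * (1 / n) ^ 2) with hSV
  have hX : ∀ i j, Measurable (cellIncrement W n i j) := fun i j =>
    measurable_cellIncrement (hW.1 _) (hW.1 _) (hW.1 _) (hW.1 _)
  have hfW : ∀ p, Measurable fun ω => f (W p ω) := fun p => hf.comp (hW.1 p)
  have mB : Measurable SB := by fun_prop
  have mY : Measurable SY := Finset.measurable_fun_sum _ fun i _ => Finset.measurable_fun_sum _
    fun j _ => (((hfW _).mul (((hX i j).pow_const 2).sub_const 1)).mul_const _).const_mul _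
  have mV : Measurable SV := Finset.measurable_fun_sum _ fun i _ => Finset.measurable_fun_sum _
    fun j _ => (((hfW _).pow_const 2).mul_const _).const_mul _
  have hβ0 : 0 ≤ β := Finset.sum_nonneg fun i _ => Finset.sum_nonneg fun j _ => by positivity
  have hVb : ∀ ω, SV ω ≤ ∑ i ∈ Finset.range n, ∑ j ∈ Finset.range n,
      c i j ^ 2 * (C ^ 2 * (1 / n) ^ 2) := fun ω => by
    refine Finset.sum_le_sum fun i _ => Finset.sum_le_sum fun j _ => ?_
    have := sq_le_sq' (abs_le.1 (hfC (W ((i : ℝ) / n, (j : ℝ) / n) ω))).1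
      (abs_le.1 (hfC (W ((i : ℝ) / n, (j : ℝ) / n) ω))).2
    gcongr
  have e1 : ∀ ω, Complex.exp (Complex.I * ((∑ i ∈ Finset.range n, ∑ j ∈ Finset.range n,
      (b i j * cellIncrement W n i j ω + c i j * f (W ((i : ℝ) / n, (j : ℝ) / n) ω) *
        (cellIncrement W n i j ω ^ 2 - 1)) * (1 / n) : ℝ) : ℂ)) *
      (Real.exp (∑ i ∈ Finset.range n, ∑ j ∈ Finset.range n,
        (b i j ^ 2 / 2 + (c i j * f (W ((i : ℝ) / n, (j : ℝ) / n) ω)) ^ 2) * (1 / n) ^ 2) : ℂ) =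
      Complex.exp (Complex.I * (SB ω : ℂ)) * (Complex.exp (Complex.I * (SY ω : ℂ)) *
        (Real.exp (SV ω) : ℂ)) * (Real.exp β : ℂ) := fun ω => by
    have i1 : (∑ i ∈ Finset.range n, ∑ j ∈ Finset.range n,
      (b i j * cellIncrement W n i j ω + c i j * f (W ((i : ℝ) / n, (j : ℝ) / n) ω) *
        (cellIncrement W n i j ω ^ 2 - 1)) * (1 / n)) = SB ω + SY ω := by
      simp only [hSB, hSY, ← Finset.sum_add_distrib]
      refine Finset.sum_congr rfl fun i _ => Finset.sum_congr rfl fun j _ => by ring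
    have i2 : (∑ i ∈ Finset.range n, ∑ j ∈ Finset.range n,
        (b i j ^ 2 / 2 + (c i j * f (W ((i : ℝ) / n, (j : ℝ) / n) ω)) ^ 2) * (1 / n) ^ 2)
        = SV ω + β := by
      simp only [hSV, hβ, ← Finset.sum_add_distrib]
      refine Finset.sum_congr rfl fun i _ => Finset.sum_congr rfl fun j _ => by ring
    rw [i1, i2, Complex.ofReal_add, mul_add, Complex.exp_add, Real.exp_add, Complex.ofReal_mul]
    ring
  have e0 : ∀ ω, Complex.exp (Complex.I * ((∑ i ∈ Finset.range n, ∑ j ∈ Finset.range n,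
      (b i j * cellIncrement W n i j ω + 0 * f (W ((i : ℝ) / n, (j : ℝ) / n) ω) *
        (cellIncrement W n i j ω ^ 2 - 1)) * (1 / n) : ℝ) : ℂ)) *
      (Real.exp (∑ i ∈ Finset.range n, ∑ j ∈ Finset.range n,
        (b i j ^ 2 / 2 + (0 * f (W ((i : ℝ) / n, (j : ℝ) / n) ω)) ^ 2) * (1 / n) ^ 2) : ℂ) =
      Complex.exp (Complex.I * (SB ω : ℂ)) * (Real.exp β : ℂ) := fun ω => by
    simp only [zero_mul, add_zero, zero_pow two_ne_zero, hSB, hβ, mul_assoc]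
  simp_rw [e1] at h1
  simp_rw [e0] at h0
  rw [integral_mul_const] at h0 h1
  have iB : Integrable (fun ω => Complex.exp (Complex.I * (SB ω : ℂ))) P :=
    (integrable_const (1 : ℝ)).mono' (by fun_prop)
      (ae_of_all _ fun ω => (norm_cexp_I_mul_ofReal _).le)
  have iBY : Integrable (fun ω => Complex.exp (Complex.I * (SB ω : ℂ)) *
      (Complex.exp (Complex.I * (SY ω : ℂ)) * (Real.exp (SV ω) : ℂ))) P := by
    refine (integrable_const (Real.exp (∑ i ∈ Finset.range n, ∑ j ∈ Finset.range n,
      c i j ^ 2 * (C ^ 2 * (1 / n) ^ 2)))).mono' (by fun_prop) (ae_of_all _ fun ω => ?_)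
    rw [norm_mul, norm_mul, norm_cexp_I_mul_ofReal, norm_cexp_I_mul_ofReal, one_mul, one_mul,
      Complex.norm_real, Real.norm_eq_abs, Real.abs_exp]
    exact Real.exp_le_exp.2 (hVb ω)
  change ‖∫ ω, Complex.exp (Complex.I * (SB ω : ℂ)) *
    (Complex.exp (Complex.I * (SY ω : ℂ)) * (Real.exp (SV ω) : ℂ) - 1) ∂P‖ ≤ _
  rw [integral_congr_ae (ae_of_all _ fun ω => mul_sub_one _ _), integral_sub iBY iB]
  have h2 := norm_sub_le_norm_sub_add_norm_sub
    ((∫ ω, Complex.exp (Complex.I * (SB ω : ℂ)) *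
      (Complex.exp (Complex.I * (SY ω : ℂ)) * (Real.exp (SV ω) : ℂ)) ∂P) * (Real.exp β : ℂ)) 1
    ((∫ ω, Complex.exp (Complex.I * (SB ω : ℂ)) ∂P) * (Real.exp β : ℂ))
  rw [← sub_mul, norm_mul, Complex.norm_real, Real.norm_eq_abs, Real.abs_exp,
    norm_sub_rev 1] at h2
  rw [add_div]
  exact (le_mul_of_one_le_right (norm_nonneg _) (Real.one_le_exp hβ0)).trans
    (h2.trans (add_le_add h1 h0))

end IsBrownianSheet

/-- The weight of the `(i, j)`-th cell of the grid of mesh `1 / n` in a linear combination of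
rectangles with lower left corner `(0, 0)`. -/
noncomputable def gridCoeff {ι : Type*} [Fintype ι] (p : ι → ℝ × ℝ) (v : ι → ℝ) (n i j : ℕ) : ℝ :=
  ∑ l, if i < Nat.floor ((n : ℝ) * (p l).1) ∧ j < Nat.floor ((n : ℝ) * (p l).2) then v l else 0

lemma abs_gridCoeff_le {ι : Type*} [Fintype ι] (p : ι → ℝ × ℝ) (v : ι → ℝ) (n i j : ℕ) :
    |gridCoeff p v n i j| ≤ ∑ l, |v l| :=
  (Finset.abs_sum_le_sum_abs _ _).trans <| Finset.sum_le_sum fun l _ => by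
    split_ifs <;> simp

lemma floor_mul_le {n : ℕ} {x : ℝ} (hx : x ≤ 1) : Nat.floor ((n : ℝ) * x) ≤ n :=
  Nat.floor_le_of_le (mul_le_of_le_one_right (by positivity) hx)

lemma sum_range_ite_lt {n N M : ℕ} (hN : N ≤ n) (hM : M ≤ n) (F : ℕ → ℕ → ℝ) (v : ℝ) :
    ∑ i ∈ Finset.range n, ∑ j ∈ Finset.range n, (if i < N ∧ j < M then v else 0) * F i j
      = v * ∑ i ∈ Finset.range N, ∑ j ∈ Finset.range M, F i j := by
  rw [Finset.mul_sum]
  rw [← Finset.sum_subset (Finset.range_mono hN) (fun i _ hi => ?_)]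
  · refine Finset.sum_congr rfl fun i hi => ?_
    rw [← Finset.sum_subset (Finset.range_mono hM) (fun j _ hj => ?_), Finset.mul_sum]
    · refine Finset.sum_congr rfl fun j hj => ?_
      rw [if_pos ⟨Finset.mem_range.1 hi, Finset.mem_range.1 hj⟩]
    · rw [if_neg fun h => hj (Finset.mem_range.2 h.2), zero_mul]
  · exact Finset.sum_eq_zero fun j _ => by
      rw [if_neg fun h => hi (Finset.mem_range.2 h.1), zero_mul]

lemma sum_gridCoeff_mul {ι : Type*} [Fintype ι] {p : ι → ℝ × ℝ} (hp : ∀ l, p l ≤ (1, 1))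
    (v : ι → ℝ) (n : ℕ) (F : ℕ → ℕ → ℝ) :
    ∑ i ∈ Finset.range n, ∑ j ∈ Finset.range n, gridCoeff p v n i j * F i j =
      ∑ l, v l * ∑ i ∈ Finset.range (Nat.floor ((n : ℝ) * (p l).1)),
        ∑ j ∈ Finset.range (Nat.floor ((n : ℝ) * (p l).2)), F i j := by
  simp_rw [gridCoeff, Finset.sum_mul]
  rw [Finset.sum_congr rfl fun i _ => Finset.sum_comm, Finset.sum_comm]
  exact Finset.sum_congr rfl fun l _ =>
    sum_range_ite_lt (floor_mul_le (hp l).1) (floor_mul_le (hp l).2) F (v l)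

lemma sum_cellIncrement {Ω : Type*} (W : ℝ × ℝ → Ω → ℝ) {n : ℕ} (hn : n ≠ 0) (N M : ℕ) (ω : Ω) :
    ∑ i ∈ Finset.range N, ∑ j ∈ Finset.range M, cellIncrement W n i j ω * (1 / n) =
      W ((N : ℝ) / n, (M : ℝ) / n) ω - W (0, (M : ℝ) / n) ω - W ((N : ℝ) / n, 0) ω + W (0, 0) ω := by
  have hn : (n : ℝ) ≠ 0 := by exact_mod_cast hn
  have h1 : ∀ i, ∑ j ∈ Finset.range M, cellIncrement W n i j ω * (1 / n) =
      (W (((i + 1 : ℕ) : ℝ) / n, (M : ℝ) / n) ω - W (((i + 1 : ℕ) : ℝ) / n, 0) ω) -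
      (W ((i : ℝ) / n, (M : ℝ) / n) ω - W ((i : ℝ) / n, 0) ω) := fun i => by
    have := Finset.sum_range_sub (fun j : ℕ => W (((i + 1 : ℕ) : ℝ) / n, (j : ℝ) / n) ω -
      W ((i : ℝ) / n, (j : ℝ) / n) ω) M
    simp only [Nat.cast_zero, zero_div] at this
    rw [sub_sub_sub_comm, ← this]
    refine Finset.sum_congr rfl fun j _ => ?_
    rw [cellIncrement]
    field_simp
    ring
  simp_rw [h1]
  rw [Finset.sum_range_sub (fun i : ℕ => W ((i : ℝ) / n, (M : ℝ) / n) ω - W ((i : ℝ) / n, 0) ω)]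
  simp only [Nat.cast_zero, zero_div]
  ring

lemma wqv_eq_sum_range {Ω : Type*} (W : ℝ × ℝ → Ω → ℝ) (f : ℝ → ℝ) {n : ℕ} (hn : n ≠ 0)
    (s t : ℝ) (ω : Ω) :
    wqv W f n s t ω = ∑ i ∈ Finset.range (Nat.floor ((n : ℝ) * s)),
      ∑ j ∈ Finset.range (Nat.floor ((n : ℝ) * t)),
        f (W ((i : ℝ) / n, (j : ℝ) / n) ω) * (cellIncrement W n i j ω ^ 2 - 1) * (1 / n) := by
  have hn : (n : ℝ) ≠ 0 := by exact_mod_cast hn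
  have hs : ∀ (N : ℕ) (F : ℕ → ℝ), ∑ i ∈ Finset.Icc 1 N, F i = ∑ i ∈ Finset.range N, F (i + 1) :=
    fun N F => by
      rw [Finset.range_eq_Ico, Finset.sum_Ico_add' F 0 N 1]
      rfl
  rw [wqv]
  simp_rw [hs, Finset.mul_sum]
  refine Finset.sum_congr rfl fun i _ => Finset.sum_congr rfl fun j _ => ?_
  rw [cellIncrement]
  push_cast
  simp only [add_sub_cancel_right]
  field_simp

lemma gridCoeff_sq {ι : Type*} [Fintype ι] (p : ι → ℝ × ℝ) (u : ι → ℝ) (n i j : ℕ) :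
    gridCoeff p u n i j ^ 2 = gridCoeff (fun q : ι × ι => (min (p q.1).1 (p q.2).1,
      min (p q.1).2 (p q.2).2)) (fun q => u q.1 * u q.2) n i j := by
  have hfl : ∀ a b : ℝ, Nat.floor ((n : ℝ) * min a b) =
      min (Nat.floor ((n : ℝ) * a)) (Nat.floor ((n : ℝ) * b)) := fun a b => by
    rw [mul_min_of_nonneg _ _ (Nat.cast_nonneg n), Nat.floor_mono.map_min]
  simp only [gridCoeff, hfl, sq, Finset.sum_mul_sum, Fintype.sum_prod_type, lt_min_iff]
  refine Finset.sum_congr rfl fun k _ => Finset.sum_congr rfl fun l _ => ?_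
  split_ifs <;> first | tauto | simp

/-- Riemann sums of `g(W)` over the rectangle with upper right corner `p`. -/
noncomputable def gridSum {Ω : Type*} (W : ℝ × ℝ → Ω → ℝ) (g : ℝ → ℝ) (n : ℕ) (p : ℝ × ℝ)
    (ω : Ω) : ℝ :=
  ∑ i ∈ Finset.range (Nat.floor ((n : ℝ) * p.1)), ∑ j ∈ Finset.range (Nat.floor ((n : ℝ) * p.2)),
    g (W ((i : ℝ) / n, (j : ℝ) / n) ω) * (1 / n) ^ 2

/-- The lower left corner of the cell of the grid of mesh `1 / n` containing `p`. -/
noncomputable def gridPoint (n : ℕ) (p : ℝ × ℝ) : ℝ × ℝ :=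
  ((Nat.floor ((n : ℝ) * p.1) : ℝ) / n, (Nat.floor ((n : ℝ) * p.2) : ℝ) / n)

namespace IsBrownianSheet

variable {Ω : Type*} [MeasurableSpace Ω] {P : Measure Ω} {W : ℝ × ℝ → Ω → ℝ}

lemma ae_eq_zero (hW : IsBrownianSheet P W) {p : ℝ × ℝ}
    (hp : p ∈ Set.Icc ((0:ℝ), (0:ℝ)) (1, 1)) (h : p.1 * p.2 = 0) : ∀ᵐ ω ∂P, W p ω = 0 := by
  have h1 := hW.map_eq hp
  rw [h, Real.toNNReal_zero, gaussianReal_zero_var] at h1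
  have h2 : ∀ᵐ x ∂(P.map (W p)), x = 0 := by
    rw [h1]
    exact (ae_dirac_iff (p := fun x : ℝ => x = 0) (measurableSet_singleton 0)).2 rfl
  exact ae_of_ae_map (hW.1 p).aemeasurable h2

lemma tendsto_integral_cexp_mul (hW : IsBrownianSheet P W) [IsProbabilityMeasure P]
    {f : ℝ → ℝ} (hf : Measurable f) {C : ℝ} (hfC : ∀ x, |f x| ≤ C) {ι κ : Type*} [Fintype ι]
    [Fintype κ] {p : ι → ℝ × ℝ} (hp : ∀ l, p l ∈ Set.Icc ((0:ℝ), (0:ℝ)) (1, 1)) (v : ι → ℝ)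
    {z : κ → ℝ × ℝ} (hz : ∀ k, z k ∈ Set.Icc ((0:ℝ), (0:ℝ)) (1, 1)) (u : κ → ℝ) :
    Tendsto (fun n : ℕ => ∫ ω, Complex.exp (Complex.I *
      ((∑ l, v l * W (gridPoint n (p l)) ω : ℝ) : ℂ)) *
      (Complex.exp (Complex.I * ((∑ k, u k * wqv W f n (z k).1 (z k).2 ω : ℝ) : ℂ)) *
        (Real.exp (∑ q : κ × κ, u q.1 * u q.2 * gridSum W (fun x => f x ^ 2) n
          (min (z q.1).1 (z q.2).1, min (z q.1).2 (z q.2).2) ω) : ℂ) - 1) ∂P) atTop (𝓝 0) := by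
  obtain ⟨K, hK⟩ := hW.exists_norm_integral_cexp_mul_sub_one_le hf hfC (∑ k, |u k|) (∑ l, |v l|)
  refine squeeze_zero_norm' ?_ (tendsto_const_div_atTop_nhds_zero_nat K)
  filter_upwards [eventually_ge_atTop 1] with n hn
  have hn0 : n ≠ 0 := by omega
  have h := hK n hn (gridCoeff p v n) (gridCoeff z u n) (abs_gridCoeff_le p v n)
    (abs_gridCoeff_le z u n)
  have hz' : ∀ q : κ × κ, (min (z q.1).1 (z q.2).1, min (z q.1).2 (z q.2).2) ≤ ((1 : ℝ), (1 : ℝ)) :=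
    fun q => ⟨(min_le_left _ _).trans (hz _).2.1, (min_le_left _ _).trans (hz _).2.2⟩
  simp_rw [gridCoeff_sq, sum_gridCoeff_mul (fun l => (hp l).2), sum_gridCoeff_mul hz',
    sum_gridCoeff_mul (fun l => (hz l).2), sum_cellIncrement W hn0] at h
  refine (le_of_eq ?_).trans h
  congr 1
  have hfl : ∀ l, gridPoint n (p l) ∈ Set.Icc ((0:ℝ), (0:ℝ)) (1, 1) := fun l =>
    grid_mem_Icc (floor_mul_le (hp l).2.1) (floor_mul_le (hp l).2.2)
  have ax1 : ∀ᵐ ω ∂P, ∀ l, W (0, (Nat.floor ((n : ℝ) * (p l).2) : ℝ) / n) ω = 0 :=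
    ae_all_iff.2 fun l => hW.ae_eq_zero ⟨⟨le_rfl, (hfl l).1.2⟩, ⟨zero_le_one, (hfl l).2.2⟩⟩ (by simp)
  have ax2 : ∀ᵐ ω ∂P, ∀ l, W ((Nat.floor ((n : ℝ) * (p l).1) : ℝ) / n, 0) ω = 0 :=
    ae_all_iff.2 fun l => hW.ae_eq_zero ⟨⟨(hfl l).1.1, le_rfl⟩, ⟨(hfl l).2.1, zero_le_one⟩⟩ (by simp)
  have ax0 : ∀ᵐ ω ∂P, W (0, 0) ω = 0 :=
    hW.ae_eq_zero ⟨⟨le_rfl, le_rfl⟩, ⟨zero_le_one, zero_le_one⟩⟩ (by simp)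
  refine integral_congr_ae ?_
  filter_upwards [ax0, ax1, ax2] with ω h0 h1 h2
  simp only [h0, h1, h2, sub_zero, add_zero, wqv_eq_sum_range W f hn0, gridSum, gridPoint]

end IsBrownianSheet

/-- If the laws of `X n` and `X` are dominated by a common finite measure, almost sure convergence
passes through merely measurable bounded functions, in the sense of `L¹` convergence. -/
lemma tendsto_integral_abs_comp_sub {Ω : Type*} [MeasurableSpace Ω] {P : Measure Ω}
    [IsProbabilityMeasure P] {X : ℕ → Ω → ℝ} {Y : Ω → ℝ} (hX : ∀ n, Measurable (X n))
    (hY : Measurable Y) {μ : Measure ℝ} [IsFiniteMeasure μ]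
    (hXμ : ∀ᶠ n in atTop, P.map (X n) ≤ μ) (hYμ : P.map Y ≤ μ)
    (hXY : ∀ ω, Tendsto (fun n => X n ω) atTop (𝓝 (Y ω))) {g : ℝ → ℝ} (hg : Measurable g)
    {D : ℝ} (hgD : ∀ x, |g x| ≤ D) :
    Tendsto (fun n => ∫ ω, |g (X n ω) - g (Y ω)| ∂P) atTop (𝓝 0) := by
  have hgi : Integrable g μ := (integrable_const D).mono' hg.aestronglyMeasurable (ae_of_all _ hgD)
  rw [Metric.tendsto_atTop']
  intro ε hε
  obtain ⟨h, hh, hhi⟩ := hgi.exists_boundedContinuous_integral_sub_le (ε := ε / 4) (by positivity)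
  have hhm : Measurable h := h.continuous.measurable
  have hb : ∀ x, |g x - h x| ≤ D + ‖h‖ := fun x =>
    (abs_sub _ _).trans (add_le_add (hgD x) (h.norm_coe_le_norm x))
  have hmap : ∀ U : Ω → ℝ, Measurable U → P.map U ≤ μ → ∫ ω, |g (U ω) - h (U ω)| ∂P ≤ ε / 4 :=
    fun U hU hUμ => by
      have hm : AEStronglyMeasurable (fun x => |g x - h x|) (P.map U) :=
        (hg.sub hhm).abs.aestronglyMeasurable
      calc ∫ ω, |g (U ω) - h (U ω)| ∂P = ∫ x, |g x - h x| ∂(P.map U) :=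
            (integral_map hU.aemeasurable hm).symm
        _ ≤ ∫ x, |g x - h x| ∂μ := integral_mono_measure hUμ (ae_of_all _ fun x => abs_nonneg _)
            (hgi.sub hhi).abs
        _ ≤ ε / 4 := hh
  have hlim : Tendsto (fun n => ∫ ω, |h (X n ω) - h (Y ω)| ∂P) atTop (𝓝 (∫ _, (0 : ℝ) ∂P)) := by
    refine tendsto_integral_of_dominated_convergence (fun _ => ‖h‖ + ‖h‖)
      (fun n => ((hhm.comp (hX n)).sub (hhm.comp hY)).abs.aestronglyMeasurable)
      (integrable_const _) (fun n => ae_of_all _ fun ω => ?_) (ae_of_all _ fun ω => ?_)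
    · rw [Real.norm_eq_abs, abs_abs]
      exact (abs_sub _ _).trans (add_le_add (h.norm_coe_le_norm _) (h.norm_coe_le_norm _))
    · have := (((h.continuous.tendsto _).comp (hXY ω)).sub_const (h (Y ω))).abs
      simpa using this
  rw [integral_zero] at hlim
  have hev := hlim.eventually (gt_mem_nhds (show (0 : ℝ) < ε / 4 by positivity))
  have hfin : ∀ᶠ n in atTop, dist (∫ ω, |g (X n ω) - g (Y ω)| ∂P) 0 < ε := by
    filter_upwards [hXμ, hev] with n hn1 hn2
    rw [Real.dist_0_eq_abs, abs_of_nonneg (integral_nonneg fun _ => abs_nonneg _)]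
    have i1 : ∀ U : Ω → ℝ, Measurable U → Integrable (fun ω => |g (U ω) - h (U ω)|) P :=
      fun U hU => (integrable_const (D + ‖h‖)).mono'
        ((hg.comp hU).sub (hhm.comp hU)).abs.aestronglyMeasurable
        (ae_of_all _ fun ω => by rw [Real.norm_eq_abs, abs_abs]; exact hb _)
    have i2 : Integrable (fun ω => |h (X n ω) - h (Y ω)|) P :=
      (integrable_const (‖h‖ + ‖h‖)).mono'
        ((hhm.comp (hX n)).sub (hhm.comp hY)).abs.aestronglyMeasurable
        (ae_of_all _ fun ω => by
          rw [Real.norm_eq_abs, abs_abs]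
          exact (abs_sub _ _).trans (add_le_add (h.norm_coe_le_norm _) (h.norm_coe_le_norm _)))
    calc ∫ ω, |g (X n ω) - g (Y ω)| ∂P
        ≤ ∫ ω, (|g (X n ω) - h (X n ω)| + |h (X n ω) - h (Y ω)|) + |g (Y ω) - h (Y ω)| ∂P := by
          refine integral_mono_of_nonneg (ae_of_all _ fun _ => abs_nonneg _)
            (((i1 _ (hX n)).add i2).add (i1 _ hY)) (ae_of_all _ fun ω => ?_)
          have a1 := abs_sub_le (g (X n ω)) (h (X n ω)) (g (Y ω))
          have a2 := abs_sub_le (h (X n ω)) (h (Y ω)) (g (Y ω))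
          rw [abs_sub_comm (h (Y ω)) (g (Y ω))] at a2
          simp only
          linarith
      _ = (∫ ω, |g (X n ω) - h (X n ω)| ∂P + ∫ ω, |h (X n ω) - h (Y ω)| ∂P) +
            ∫ ω, |g (Y ω) - h (Y ω)| ∂P := by
          rw [← integral_add (i1 _ (hX n)) i2]
          exact integral_add ((i1 _ (hX n)).add i2) (i1 _ hY)
      _ < ε := by linarith [hmap _ (hX n) hn1, hmap _ hY hYμ]
  obtain ⟨N, hN⟩ := eventually_atTop.1 hfin
  exact ⟨N, fun n hn => hN n hn.le⟩

lemma gaussianReal_le_smul {a v : NNReal} (ha : a ≠ 0) (hav : a ≤ v) (hv : v ≤ 1) :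
    gaussianReal 0 v ≤ ENNReal.ofReal (√a)⁻¹ • gaussianReal 0 1 := by
  have ha' : 0 < a := pos_iff_ne_zero.2 ha
  have hv0 : v ≠ 0 := (ha'.trans_le hav).ne'
  rw [gaussianReal_of_var_ne_zero 0 hv0, gaussianReal_of_var_ne_zero 0 one_ne_zero,
    ← withDensity_smul _ (measurable_gaussianPDF 0 1)]
  refine withDensity_mono (ae_of_all _ fun x => ?_)
  rw [gaussianPDF_def, gaussianPDF_def, Pi.smul_apply, smul_eq_mul,
    ← ENNReal.ofReal_mul (by positivity), gaussianPDFReal_def, gaussianPDFReal_def]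
  refine ENNReal.ofReal_le_ofReal ?_
  have ha1 : (0 : ℝ) < a := ha'
  have hv1 : (0 : ℝ) < v := ha'.trans_le hav
  have hv2 : (v : ℝ) ≤ 1 := hv
  have hav2 : (a : ℝ) ≤ v := hav
  simp only [sub_zero, NNReal.coe_one, mul_one]
  rw [← mul_assoc, Real.sqrt_mul (by positivity) (v : ℝ), mul_inv, mul_comm (√(a : ℝ))⁻¹]
  refine mul_le_mul (mul_le_mul_of_nonneg_left ?_ (by positivity)) ?_ (Real.exp_nonneg _)
    (by positivity)
  · exact inv_anti₀ (Real.sqrt_pos.2 ha1) (Real.sqrt_le_sqrt hav2)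
  · refine Real.exp_le_exp.2 ?_
    rw [neg_div, neg_div, neg_le_neg_iff]
    exact div_le_div_of_nonneg_left (sq_nonneg x) (by positivity) (by linarith)

lemma tendsto_gridPoint {p : ℝ × ℝ} (hp : p ∈ Set.Icc ((0:ℝ), (0:ℝ)) (1, 1)) :
    Tendsto (fun n => gridPoint n p) atTop (𝓝 p) := by
  have h : ∀ x : ℝ, 0 ≤ x → Tendsto (fun n : ℕ => (Nat.floor ((n : ℝ) * x) : ℝ) / n) atTop (𝓝 x) :=
    fun x hx => by
      have := (tendsto_nat_floor_mul_div_atTop hx).comp tendsto_natCast_atTop_atTop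
      simpa [Function.comp_def, mul_comm] using this
  exact (h p.1 hp.1.1).prodMk_nhds (h p.2 hp.1.2)

lemma gridPoint_mem_Icc {p : ℝ × ℝ} (hp : p ∈ Set.Icc ((0:ℝ), (0:ℝ)) (1, 1)) (n : ℕ) :
    gridPoint n p ∈ Set.Icc ((0:ℝ), (0:ℝ)) (1, 1) :=
  grid_mem_Icc (floor_mul_le hp.2.1) (floor_mul_le hp.2.2)

lemma measurable_gridPoint (n : ℕ) : Measurable (gridPoint n) := by
  have h : ∀ f : ℝ × ℝ → ℝ, Measurable f → Measurable fun p => (Nat.floor ((n : ℝ) * f p) : ℝ) / n :=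
    fun f hf => ((measurable_from_top (f := fun k : ℕ => (k : ℝ))).comp
      (Nat.measurable_floor.comp (hf.const_mul _))).div_const _
  exact (h _ measurable_fst).prodMk (h _ measurable_snd)

namespace IsBrownianSheet

variable {Ω : Type*} [MeasurableSpace Ω] {P : Measure Ω} {W : ℝ × ℝ → Ω → ℝ}

lemma tendsto_integral_abs_comp_gridPoint_sub (hW : IsBrownianSheet P W) [IsProbabilityMeasure P]
    (hWc : ∀ ω, Continuous fun z => W z ω) {g : ℝ → ℝ} (hg : Measurable g)
    {D : ℝ} (hgD : ∀ x, |g x| ≤ D) {ρ : ℝ × ℝ} (hρ : ρ ∈ Set.Icc ((0:ℝ), (0:ℝ)) (1, 1))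
    (h1 : 0 < ρ.1) (h2 : 0 < ρ.2) :
    Tendsto (fun n => ∫ ω, |g (W (gridPoint n ρ) ω) - g (W ρ ω)| ∂P) atTop (𝓝 0) := by
  have hpos : 0 < ρ.1 * ρ.2 := mul_pos h1 h2
  have ha : Real.toNNReal (ρ.1 * ρ.2 / 2) ≠ 0 := (Real.toNNReal_pos.2 (by positivity)).ne'
  have hle1 : ∀ q ∈ Set.Icc ((0:ℝ), (0:ℝ)) (1, 1), Real.toNNReal (q.1 * q.2) ≤ 1 := fun q hq =>
    Real.toNNReal_le_one.2 (mul_le_one₀ hq.2.1 hq.1.2 hq.2.2)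
  have := (gaussianReal 0 1).smul_finite
    (ENNReal.ofReal_ne_top (r := (√(Real.toNNReal (ρ.1 * ρ.2 / 2)))⁻¹))
  refine tendsto_integral_abs_comp_sub (fun n => hW.1 _) (hW.1 _)
    (μ := ENNReal.ofReal (√(Real.toNNReal (ρ.1 * ρ.2 / 2)))⁻¹ • gaussianReal 0 1) ?_ ?_
    (fun ω => ((hWc ω).tendsto ρ).comp (tendsto_gridPoint hρ)) hg hgD
  · have hlim : Tendsto (fun n => (gridPoint n ρ).1 * (gridPoint n ρ).2) atTop (𝓝 (ρ.1 * ρ.2)) :=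
      ((continuous_fst.mul continuous_snd).tendsto ρ).comp (tendsto_gridPoint hρ)
    filter_upwards [hlim.eventually (lt_mem_nhds (half_lt_self hpos))] with n hn
    rw [hW.map_eq (gridPoint_mem_Icc hρ n)]
    exact gaussianReal_le_smul ha (Real.toNNReal_le_toNNReal hn.le)
      (hle1 _ (gridPoint_mem_Icc hρ n))
  · rw [hW.map_eq hρ]
    exact gaussianReal_le_smul ha (Real.toNNReal_le_toNNReal (half_le_self hpos.le)) (hle1 _ hρ)

end IsBrownianSheet

lemma mem_Ico_div_iff {n i : ℕ} (hn : n ≠ 0) {x : ℝ} (hx : 0 ≤ x) :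
    x ∈ Set.Ico ((i : ℝ) / n) ((i + 1 : ℝ) / n) ↔ Nat.floor ((n : ℝ) * x) = i := by
  have hn : (0 : ℝ) < n := by exact_mod_cast Nat.pos_of_ne_zero hn
  rw [Nat.floor_eq_iff (by positivity), Set.mem_Ico, div_le_iff₀ hn, lt_div_iff₀ hn, mul_comm]

lemma gridSum_eq_setIntegral {Ω : Type*} (W : ℝ × ℝ → Ω → ℝ) (g : ℝ → ℝ) {n : ℕ} (hn : n ≠ 0)
    {p : ℝ × ℝ} (hp : 0 ≤ p) (ω : Ω) :
    gridSum W g n p ω = ∫ ρ in Set.Ioo 0 p.1 ×ˢ Set.Ioo 0 p.2,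
      if Nat.floor ((n : ℝ) * ρ.1) < Nat.floor ((n : ℝ) * p.1) ∧
        Nat.floor ((n : ℝ) * ρ.2) < Nat.floor ((n : ℝ) * p.2)
      then g (W (gridPoint n ρ) ω) else 0 := by
  have hn' : (0 : ℝ) < n := by exact_mod_cast Nat.pos_of_ne_zero hn
  have hset : (Set.Ioo 0 p.1 ×ˢ Set.Ioo 0 p.2 : Set (ℝ × ℝ)) =ᵐ[volume]
      Set.Ico 0 p.1 ×ˢ Set.Ico 0 p.2 :=
    Measure.set_prod_ae_eq Ioo_ae_eq_Ico Ioo_ae_eq_Ico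
  rw [setIntegral_congr_set hset]
  let cell : ℕ → ℕ → Set (ℝ × ℝ) := fun i j =>
    Set.Ico ((i : ℝ) / n) ((i + 1 : ℝ) / n) ×ˢ Set.Ico ((j : ℝ) / n) ((j + 1 : ℝ) / n)
  have hcell : ∀ i j, MeasurableSet (cell i j) := fun i j => measurableSet_Ico.prod measurableSet_Ico
  have hsub : ∀ (x : ℝ) (i : ℕ), 0 ≤ x → i < Nat.floor ((n : ℝ) * x) →
      Set.Ico ((i : ℝ) / n) ((i + 1 : ℝ) / n) ⊆ Set.Ico 0 x := fun x i hx hi => by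
    refine Set.Ico_subset_Ico (by positivity) ?_
    rw [div_le_iff₀ hn', mul_comm]
    have : ((i + 1 : ℕ) : ℝ) ≤ n * x := (Nat.cast_le.2 hi).trans (Nat.floor_le (by positivity))
    exact_mod_cast this
  have hpt : ∀ ρ ∈ (Set.Ico 0 p.1 ×ˢ Set.Ico 0 p.2 : Set (ℝ × ℝ)),
      (if Nat.floor ((n : ℝ) * ρ.1) < Nat.floor ((n : ℝ) * p.1) ∧
        Nat.floor ((n : ℝ) * ρ.2) < Nat.floor ((n : ℝ) * p.2)
      then g (W (gridPoint n ρ) ω) else 0) = ∑ i ∈ Finset.range (Nat.floor ((n : ℝ) * p.1)),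
        ∑ j ∈ Finset.range (Nat.floor ((n : ℝ) * p.2)),
          (cell i j).indicator (fun _ => g (W ((i : ℝ) / n, (j : ℝ) / n) ω)) ρ := fun ρ hρ => by
    have e : ∀ i j, (cell i j).indicator (fun _ => g (W ((i : ℝ) / n, (j : ℝ) / n) ω)) ρ =
        if Nat.floor ((n : ℝ) * ρ.1) = i then (if Nat.floor ((n : ℝ) * ρ.2) = j then
          g (W ((i : ℝ) / n, (j : ℝ) / n) ω) else 0) else 0 := fun i j => by
      rw [← ite_and, Set.indicator_apply]
      refine if_congr ?_ rfl rfl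
      rw [Set.mem_prod, mem_Ico_div_iff hn hρ.1.1, mem_Ico_div_iff hn hρ.2.1]
    simp_rw [e]
    have e' : ∀ i, (∑ j ∈ Finset.range (Nat.floor ((n : ℝ) * p.2)),
        if Nat.floor ((n : ℝ) * ρ.1) = i then (if Nat.floor ((n : ℝ) * ρ.2) = j then
          g (W ((i : ℝ) / n, (j : ℝ) / n) ω) else 0) else 0) =
        if Nat.floor ((n : ℝ) * ρ.1) = i then
          (if Nat.floor ((n : ℝ) * ρ.2) < Nat.floor ((n : ℝ) * p.2) then
            g (W ((i : ℝ) / n, (Nat.floor ((n : ℝ) * ρ.2) : ℝ) / n) ω) else 0) else 0 := fun i => by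
      split_ifs <;> simp_all
    simp_rw [e', Finset.sum_ite_eq, Finset.mem_range, ite_and, gridPoint]
  rw [setIntegral_congr_fun (measurableSet_Ico.prod measurableSet_Ico) hpt, gridSum]
  have hint : ∀ i j, Integrable ((cell i j).indicator
      (fun _ => g (W ((i : ℝ) / n, (j : ℝ) / n) ω)))
      (volume.restrict (Set.Ico 0 p.1 ×ˢ Set.Ico 0 p.2)) := fun i j => by
    have : IsFiniteMeasure (volume.restrict (Set.Ico 0 p.1 ×ˢ Set.Ico 0 p.2 : Set (ℝ × ℝ))) :=
      ⟨by
        rw [Measure.restrict_apply_univ, Measure.volume_eq_prod, Measure.prod_prod]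
        simp [ENNReal.mul_lt_top]⟩
    exact (integrable_const _).indicator (hcell i j)
  rw [integral_finsetSum _ fun i _ => integrable_finsetSum _ fun j _ => hint i j]
  refine Finset.sum_congr rfl fun i hi => ?_
  rw [integral_finsetSum _ fun j _ => hint i j]
  refine Finset.sum_congr rfl fun j hj => ?_
  rw [integral_indicator_const _ (hcell i j), measureReal_restrict_apply (hcell i j),
    Set.inter_eq_left.2 (Set.prod_mono (hsub _ _ hp.1 (Finset.mem_range.1 hi))
      (hsub _ _ hp.2 (Finset.mem_range.1 hj))), Measure.volume_eq_prod, measureReal_prod_prod,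
    Real.volume_real_Ico_of_le (by gcongr; linarith), Real.volume_real_Ico_of_le (by gcongr; linarith)]
  simp only [smul_eq_mul]
  field_simp
  ring

lemma eventually_floor_lt_floor {x y : ℝ} (hx : 0 ≤ x) (hxy : x < y) :
    ∀ᶠ n : ℕ in atTop, Nat.floor ((n : ℝ) * x) < Nat.floor ((n : ℝ) * y) := by
  obtain ⟨N, hN⟩ := exists_nat_gt (1 / (y - x))
  filter_upwards [eventually_ge_atTop N] with n hn
  have h1 : 1 < (n : ℝ) * (y - x) := by
    rw [← div_lt_iff₀ (by linarith)]
    exact hN.trans_le (by exact_mod_cast hn)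
  refine Nat.lt_of_lt_of_le (Nat.lt_succ_self _) (Nat.le_floor ?_)
  push_cast
  have := Nat.floor_le (show 0 ≤ (n : ℝ) * x by positivity)
  linarith

namespace IsBrownianSheet

variable {Ω : Type*} [MeasurableSpace Ω] {P : Measure Ω} {W : ℝ × ℝ → Ω → ℝ}

lemma measurable_uncurry (hW : IsBrownianSheet P W) (hWc : ∀ ω, Continuous fun z => W z ω) :
    Measurable (Function.uncurry W) :=
  measurable_uncurry_of_continuous_of_measurable hWc hW.1

lemma tendsto_integral_abs_gridSum_sub (hW : IsBrownianSheet P W) [IsProbabilityMeasure P]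
    (hWc : ∀ ω, Continuous fun z => W z ω) {g : ℝ → ℝ} (hg : Measurable g)
    {D : ℝ} (hgD : ∀ x, |g x| ≤ D) {p : ℝ × ℝ} (hp : p ∈ Set.Icc ((0:ℝ), (0:ℝ)) (1, 1)) :
    Tendsto (fun n => ∫ ω, |gridSum W g n p ω -
      ∫ ρ in Set.Icc 0 p.1 ×ˢ Set.Icc 0 p.2, g (W ρ ω)| ∂P) atTop (𝓝 0) := by
  have hset : (Set.Ioo 0 p.1 ×ˢ Set.Ioo 0 p.2 : Set (ℝ × ℝ)) =ᵐ[volume]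
      Set.Icc 0 p.1 ×ˢ Set.Icc 0 p.2 :=
    Measure.set_prod_ae_eq Ioo_ae_eq_Icc Ioo_ae_eq_Icc
  simp_rw [← setIntegral_congr_set hset]
  set ν : Measure (ℝ × ℝ) := volume.restrict (Set.Ioo 0 p.1 ×ˢ Set.Ioo 0 p.2) with hν
  have hνf : IsFiniteMeasure ν := ⟨by
    rw [hν, Measure.restrict_apply_univ, Measure.volume_eq_prod, Measure.prod_prod]
    simp [ENNReal.mul_lt_top]⟩
  let R : ℕ → Set (ℝ × ℝ) := fun n => {ρ | Nat.floor ((n : ℝ) * ρ.1) < Nat.floor ((n : ℝ) * p.1) ∧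
        Nat.floor ((n : ℝ) * ρ.2) < Nat.floor ((n : ℝ) * p.2)}
  have hR : ∀ n, MeasurableSet (R n) := fun n => by
    have h : ∀ f : ℝ × ℝ → ℝ, Measurable f → ∀ N : ℕ,
        MeasurableSet {ρ | Nat.floor ((n : ℝ) * f ρ) < N} := fun f hf N =>
      measurableSet_lt (Nat.measurable_floor.comp (hf.const_mul _)) measurable_const
    exact (h _ measurable_fst _).inter (h _ measurable_snd _)
  let φ : ℕ → Ω → ℝ × ℝ → ℝ := fun n ω ρ =>
    (R n).indicator (fun ρ => g (W (gridPoint n ρ) ω)) ρ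
  have hD : 0 ≤ D := (abs_nonneg _).trans (hgD 0)
  have hφD : ∀ n ω ρ, |φ n ω ρ| ≤ D := fun n ω ρ => by
    simp only [φ, Set.indicator_apply]
    split_ifs
    · exact hgD _
    · simpa
  have hWm := hW.measurable_uncurry hWc
  have hφm : ∀ n, Measurable (Function.uncurry (φ n)) := fun n => by
    have h : Measurable (fun q : Ω × (ℝ × ℝ) => g (W (gridPoint n q.2) q.1)) :=
      hg.comp (hWm.comp (((measurable_gridPoint n).comp measurable_snd).prodMk measurable_fst))
    exact h.indicator (measurable_snd (hR n))
  have hgm : Measurable (Function.uncurry fun (ω : Ω) (ρ : ℝ × ℝ) => g (W ρ ω)) :=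
    hg.comp (hWm.comp measurable_swap)
  have hgs : ∀ n, n ≠ 0 → ∀ ω, gridSum W g n p ω = ∫ ρ, φ n ω ρ ∂ν := fun n hn ω => by
    rw [gridSum_eq_setIntegral W g hn hp.1 ω]
    simp only [φ, Set.indicator_apply]
    rfl
  have hint : ∀ n ω, Integrable (φ n ω) ν := fun n ω =>
    (integrable_const D).mono' ((hφm n).comp measurable_prodMk_left).aestronglyMeasurable
      (ae_of_all _ (hφD n ω))
  have hintg : ∀ ω, Integrable (fun ρ => g (W ρ ω)) ν := fun ω =>
    (integrable_const D).mono' (hgm.comp measurable_prodMk_left).aestronglyMeasurable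
      (ae_of_all _ fun ρ => hgD _)
  have hdm : ∀ n, Measurable (Function.uncurry fun ω ρ => |φ n ω ρ - g (W ρ ω)|) := fun n =>
    ((hφm n).sub hgm).abs
  have hdb : ∀ n ω ρ, |φ n ω ρ - g (W ρ ω)| ≤ D + D := fun n ω ρ =>
    (abs_sub _ _).trans (add_le_add (hφD n ω ρ) (hgD _))
  have hdi : ∀ n, Integrable (Function.uncurry fun ω ρ => |φ n ω ρ - g (W ρ ω)|) (P.prod ν) :=
    fun n => (integrable_const (D + D)).mono' (hdm n).aestronglyMeasurable
      (ae_of_all _ fun q => by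
        simp only [Function.uncurry, Real.norm_eq_abs, abs_abs]
        exact hdb n _ _)
  have hlim : Tendsto (fun n => ∫ ρ, ∫ ω, |φ n ω ρ - g (W ρ ω)| ∂P ∂ν) atTop
      (𝓝 (∫ _, (0 : ℝ) ∂ν)) := by
    refine tendsto_integral_of_dominated_convergence (fun _ => D + D)
      (fun n => (hdi n).integral_prod_right.aestronglyMeasurable) (integrable_const _)
      (fun n => ae_of_all _ fun ρ => ?_) ?_
    · have := norm_integral_le_of_norm_le_const (μ := P) (C := D + D)
        (f := fun ω => |φ n ω ρ - g (W ρ ω)|) (ae_of_all _ fun ω => by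
          rw [Real.norm_eq_abs, abs_abs]; exact hdb n ω ρ)
      simpa using this
    · refine (ae_restrict_iff' (measurableSet_Ioo.prod measurableSet_Ioo)).2
        (ae_of_all _ fun ρ hρ => ?_)
      have hρI : ρ ∈ Set.Icc ((0:ℝ), (0:ℝ)) (1, 1) :=
        ⟨⟨hρ.1.1.le, hρ.2.1.le⟩, ⟨hρ.1.2.le.trans hp.2.1, hρ.2.2.le.trans hp.2.2⟩⟩
      refine (hW.tendsto_integral_abs_comp_gridPoint_sub hWc hg hgD hρI hρ.1.1 hρ.2.1).congr' ?_
      filter_upwards [eventually_floor_lt_floor hρ.1.1.le hρ.1.2,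
        eventually_floor_lt_floor hρ.2.1.le hρ.2.2] with n h1 h2
      have : ρ ∈ R n := ⟨h1, h2⟩
      simp only [φ, Set.indicator_of_mem this]
  rw [integral_zero] at hlim
  refine squeeze_zero' (Eventually.of_forall fun n => integral_nonneg fun _ => abs_nonneg _) ?_ hlim
  filter_upwards [eventually_ne_atTop 0] with n hn
  rw [← integral_integral_swap (hdi n)]
  refine integral_mono_of_nonneg (ae_of_all _ fun _ => abs_nonneg _) (hdi n).integral_prod_left
    (ae_of_all _ fun ω => ?_)
  simp only
  rw [hgs n hn, ← integral_sub (hint n ω) (hintg ω)]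
  exact abs_integral_le_integral_abs

end IsBrownianSheet

/-- Weak convergence to zero of a bounded sequence of a Hilbert space can be tested on a set and on
its orthogonal complement. -/
lemma tendsto_inner_zero_of_orthogonal {H : Type*} [NormedAddCommGroup H] [InnerProductSpace ℝ H]
    [CompleteSpace H] {a : ℕ → H} {B : ℝ} (ha : ∀ n, ‖a n‖ ≤ B) (A : Set H)
    (hA : ∀ x ∈ A, Tendsto (fun n => inner ℝ x (a n)) atTop (𝓝 0))
    (hA' : ∀ y, (∀ x ∈ A, inner ℝ x y = 0) → Tendsto (fun n => inner ℝ y (a n)) atTop (𝓝 0))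
    (z : H) : Tendsto (fun n => inner ℝ z (a n)) atTop (𝓝 0) := by
  let S : Submodule ℝ H :=
    { carrier := {x | Tendsto (fun n => inner ℝ x (a n)) atTop (𝓝 0)}
      add_mem' := fun {x y} hx hy => by
        simpa [inner_add_left] using Tendsto.add (f := fun n => inner ℝ x (a n)) hx hy
      zero_mem' := by simp
      smul_mem' := fun c x hx => by
        simpa [real_inner_smul_left] using
          Tendsto.const_mul (f := fun n => inner ℝ x (a n)) c hx }
  have hB : 0 ≤ B := (norm_nonneg _).trans (ha 0)
  have hS : IsClosed (S : Set H) := by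
    refine isClosed_of_closure_subset fun x hx => ?_
    change Tendsto (fun n => inner ℝ x (a n)) atTop (𝓝 0)
    rw [Metric.tendsto_atTop]
    intro ε hε
    obtain ⟨y, hy, hxy⟩ := Metric.mem_closure_iff.1 hx (ε / (2 * (B + 1))) (by positivity)
    obtain ⟨N, hN⟩ := Metric.tendsto_atTop.1 hy (ε / 2) (by positivity)
    refine ⟨N, fun n hn => ?_⟩
    have h1 := hN n hn
    rw [Real.dist_0_eq_abs] at h1 ⊢
    have h2 : inner ℝ x (a n) = inner ℝ (x - y) (a n) + inner ℝ y (a n) := by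
      rw [inner_sub_left]; ring
    have h3 : |inner ℝ (x - y) (a n)| ≤ ε / 2 := by
      refine (abs_real_inner_le_norm _ _).trans ?_
      rw [dist_eq_norm] at hxy
      calc ‖x - y‖ * ‖a n‖ ≤ ε / (2 * (B + 1)) * (B + 1) :=
            mul_le_mul hxy.le ((ha n).trans (by linarith)) (norm_nonneg _) (by positivity)
        _ = ε / 2 := by field_simp
    rw [h2]
    linarith [abs_add_le (inner ℝ (x - y) (a n)) (inner ℝ y (a n))]
  have hle : (Submodule.span ℝ A).topologicalClosure ≤ S :=
    Submodule.topologicalClosure_minimal _ (Submodule.span_le.2 hA) hS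
  have : CompleteSpace (Submodule.span ℝ A).topologicalClosure :=
    (Submodule.isClosed_topologicalClosure _).completeSpace_coe
  obtain ⟨y, hy, w, hw, rfl⟩ :=
    (Submodule.span ℝ A).topologicalClosure.exists_add_mem_mem_orthogonal z
  have h1 : Tendsto (fun n => inner ℝ y (a n)) atTop (𝓝 0) := hle hy
  have h2 := hA' w fun x hx => (Submodule.mem_orthogonal _ w).1 hw x
    (Submodule.le_topologicalClosure _ (Submodule.subset_span hx))
  simpa [inner_add_left] using h1.add h2

/-- `tendsto_inner_zero_of_orthogonal` in `L²`. -/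
lemma tendsto_integral_mul_zero_of_orthogonal {Ω : Type*} [MeasurableSpace Ω] {P : Measure Ω}
    [IsProbabilityMeasure P] {a : ℕ → Ω → ℝ} (ham : ∀ n, Measurable (a n)) {B : ℝ}
    (ha : ∀ n ω, |a n ω| ≤ B) {A : Set (Ω → ℝ)} (hA2 : ∀ x ∈ A, MemLp x 2 P)
    (hA : ∀ x ∈ A, Tendsto (fun n => ∫ ω, x ω * a n ω ∂P) atTop (𝓝 0))
    (hA' : ∀ y, MemLp y 2 P → (∀ x ∈ A, ∫ ω, x ω * y ω ∂P = 0) →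
      Tendsto (fun n => ∫ ω, y ω * a n ω ∂P) atTop (𝓝 0))
    {z : Ω → ℝ} (hz : MemLp z 2 P) : Tendsto (fun n => ∫ ω, z ω * a n ω ∂P) atTop (𝓝 0) := by
  have ha2 : ∀ n, MemLp (a n) 2 P := fun n =>
    MemLp.of_bound (ham n).aestronglyMeasurable B (ae_of_all _ (ha n))
  have hin : ∀ (x y : Ω → ℝ) (hx : MemLp x 2 P) (hy : MemLp y 2 P),
      inner ℝ (hx.toLp x) (hy.toLp y) = ∫ ω, x ω * y ω ∂P := fun x y hx hy => by
    rw [L2.inner_def]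
    refine integral_congr_ae ?_
    filter_upwards [hx.coeFn_toLp, hy.coeFn_toLp] with ω h1 h2
    rw [h1, h2]
    simp [mul_comm]
  have hB : 0 ≤ B := by
    obtain ⟨ω⟩ := P.nonempty_of_neZero
    exact (abs_nonneg _).trans (ha 0 ω)
  have key := tendsto_inner_zero_of_orthogonal (a := fun n => (ha2 n).toLp (a n))
    (B := measureUnivNNReal P ^ ((2 : ENNReal).toReal⁻¹) * B)
    (fun n => by
      refine Lp.norm_le_of_ae_bound hB ?_
      filter_upwards [(ha2 n).coeFn_toLp] with ω h1
      rw [h1]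
      exact ha n ω)
    {x | ∃ x' : Ω → ℝ, ∃ h : x' ∈ A, (hA2 x' h).toLp x' = x} ?_ ?_ (hz.toLp z)
  · simpa only [hin] using key
  · rintro _ ⟨x, hx, rfl⟩
    simpa only [hin] using hA x hx
  · intro y hy
    have e : y = (Lp.memLp y).toLp y := (Lp.toLp_coeFn y (Lp.memLp y)).symm
    rw [e]
    simp only [hin]
    refine hA' _ (Lp.memLp y) fun x hx => ?_
    rw [← hin x y (hA2 x hx) (Lp.memLp y), ← e]
    exact hy _ ⟨x, hx, rfl⟩

/-- A random variable which is orthogonal to all the trigonometric functionals of a random vector is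
orthogonal to all its bounded functionals. -/
lemma integral_mul_eq_zero_of_integral_mul_cexp {Ω : Type*} [MeasurableSpace Ω] {P : Measure Ω}
    {ι : Type*} [Fintype ι] {X : ι → Ω → ℝ} (hX : ∀ i, Measurable (X i)) {η : Ω → ℝ}
    (hη : Integrable η P) (hc : ∀ v : ι → ℝ, ∫ ω, η ω * Real.cos (∑ i, v i * X i ω) ∂P = 0)
    (hs : ∀ v : ι → ℝ, ∫ ω, η ω * Real.sin (∑ i, v i * X i ω) ∂P = 0) {G : Ω → ℝ}
    (hG : Measurable[MeasurableSpace.comap (fun ω i => X i ω) inferInstance] G) {D : ℝ}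
    (hGD : ∀ ω, |G ω| ≤ D) : ∫ ω, η ω * G ω ∂P = 0 := by
  classical
  have hXm : Measurable fun ω i => X i ω := measurable_pi_lambda _ hX
  have hGm : Measurable G := hG.mono hXm.comap_le le_rfl
  obtain ⟨F, hF, rfl⟩ := hG.exists_eq_measurable_comp
  let ηp : Ω → NNReal := fun ω => Real.toNNReal (η ω)
  let ηn : Ω → NNReal := fun ω => Real.toNNReal (-η ω)
  have hp : AEMeasurable ηp P := hη.aestronglyMeasurable.aemeasurable.real_toNNReal
  have hn : AEMeasurable ηn P := hη.neg.aestronglyMeasurable.aemeasurable.real_toNNReal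
  have hηe : ∀ ω, η ω = (ηp ω : ℝ) - ηn ω := fun ω => by
    simp only [ηp, ηn, Real.coe_toNNReal']
    rcases le_total 0 (η ω) with h | h
    · rw [max_eq_left h, max_eq_right (by linarith)]; ring
    · rw [max_eq_right h, max_eq_left (by linarith)]; ring
  have hpi : Integrable (fun ω => (ηp ω : ℝ)) P := hη.real_toNNReal
  have hni : Integrable (fun ω => (ηn ω : ℝ)) P := hη.neg.real_toNNReal
  let μp := (P.withDensity fun ω => (ηp ω : ENNReal)).map fun ω i => X i ω
  let μn := (P.withDensity fun ω => (ηn ω : ENNReal)).map fun ω i => X i ω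
  have hfp : IsFiniteMeasure (P.withDensity fun ω => (ηp ω : ENNReal)) :=
    isFiniteMeasure_withDensity_ofReal hη.2
  have hfn : IsFiniteMeasure (P.withDensity fun ω => (ηn ω : ENNReal)) :=
    isFiniteMeasure_withDensity_ofReal hη.neg.2
  have hμ : μp = μn := by
    refine Measure.ext_of_charFunDual ?_
    ext L
    let v : ι → ℝ := fun i => L (Pi.single i 1)
    have hL : ∀ ω, L (fun i => X i ω) = ∑ i, v i * X i ω := fun ω => by
      have := LinearMap.pi_apply_eq_sum_univ L.toLinearMap (fun i => X i ω)
      simp only [ContinuousLinearMap.coe_coe, smul_eq_mul] at this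
      rw [this]
      refine Finset.sum_congr rfl fun i _ => ?_
      have e : (fun j => if i = j then (1 : ℝ) else 0) = Pi.single i 1 := by
        ext j
        simp [Pi.single_apply, eq_comm]
      rw [e, mul_comm]
    have hLm : Measurable fun ω => ∑ i, v i * X i ω :=
      Finset.measurable_fun_sum _ fun i _ => (hX i).const_mul _
    have hi : ∀ h : Ω → NNReal, Integrable (fun ω => (h ω : ℝ)) P → Integrable (fun ω => h ω •
        Complex.exp (((∑ i, v i * X i ω : ℝ) : ℂ) * Complex.I)) P := fun h hh => by
      refine Integrable.mono' hh (hh.aestronglyMeasurable.smul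
        (by fun_prop : Measurable fun ω => Complex.exp (((∑ i, v i * X i ω : ℝ) : ℂ) *
          Complex.I)).aestronglyMeasurable) (ae_of_all _ fun ω => ?_)
      rw [NNReal.smul_def, norm_smul, Complex.norm_exp_ofReal_mul_I, mul_one]
      simp
    have hmE : AEStronglyMeasurable (fun x : ι → ℝ => Complex.exp ((L x : ℂ) * Complex.I)) μp :=
      (by fun_prop : Continuous fun x : ι → ℝ =>
        Complex.exp ((L x : ℂ) * Complex.I)).aestronglyMeasurable
    have hmE' : AEStronglyMeasurable (fun x : ι → ℝ => Complex.exp ((L x : ℂ) * Complex.I)) μn :=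
      (by fun_prop : Continuous fun x : ι → ℝ =>
        Complex.exp ((L x : ℂ) * Complex.I)).aestronglyMeasurable
    rw [charFunDual_apply, charFunDual_apply, integral_map hXm.aemeasurable hmE,
      integral_map hXm.aemeasurable hmE', integral_withDensity_eq_integral_smul₀ hp,
      integral_withDensity_eq_integral_smul₀ hn]
    simp_rw [hL]
    rw [← sub_eq_zero, ← integral_sub (hi ηp hpi) (hi ηn hni)]
    have e : ∀ ω, ηp ω • Complex.exp (((∑ i, v i * X i ω : ℝ) : ℂ) * Complex.I) -
        ηn ω • Complex.exp (((∑ i, v i * X i ω : ℝ) : ℂ) * Complex.I) =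
        ((η ω * Real.cos (∑ i, v i * X i ω) : ℝ) : ℂ) +
          ((η ω * Real.sin (∑ i, v i * X i ω) : ℝ) : ℂ) * Complex.I := fun ω => by
      rw [NNReal.smul_def, NNReal.smul_def, ← sub_smul, ← hηe, Complex.real_smul, Complex.exp_mul_I]
      push_cast
      ring
    simp_rw [e]
    have ib : ∀ h : Ω → ℝ, Measurable h → (∀ ω, |h ω| ≤ 1) → Integrable (fun ω => η ω * h ω) P :=
      fun h hh hb => hη.mul_bdd hh.aestronglyMeasurable (ae_of_all _ hb)
    rw [integral_add (ib _ (Real.measurable_cos.comp hLm) fun _ => Real.abs_cos_le_one _).ofReal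
      ((ib _ (Real.measurable_sin.comp hLm) fun _ => Real.abs_sin_le_one _).ofReal.mul_const _),
      integral_mul_const, integral_complex_ofReal, integral_complex_ofReal, hc, hs]
    simp
  have hi : ∀ h : Ω → NNReal, Integrable (fun ω => (h ω : ℝ)) P → Integrable (fun ω => h ω •
      F (fun i => X i ω)) P := fun h hh =>
    hh.mul_bdd hGm.aestronglyMeasurable (ae_of_all _ hGD)
  have hEq : ∫ x, F x ∂μp = ∫ x, F x ∂μn := by rw [hμ]
  rw [integral_map hXm.aemeasurable hF.aestronglyMeasurable,
    integral_map hXm.aemeasurable hF.aestronglyMeasurable,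
    integral_withDensity_eq_integral_smul₀ hp, integral_withDensity_eq_integral_smul₀ hn,
    ← sub_eq_zero, ← integral_sub (hi ηp hpi) (hi ηn hni)] at hEq
  rw [← hEq]
  refine integral_congr_ae (ae_of_all _ fun ω => ?_)
  simp only [Function.comp, NNReal.smul_def, smul_eq_mul, hηe ω]
  ring

/-- Convergence in `L¹` of a bounded sequence implies convergence in `L²`. -/
lemma tendsto_integral_abs_mul_of_bounded {Ω : Type*} [MeasurableSpace Ω] {P : Measure Ω}
    [IsProbabilityMeasure P] {d : ℕ → Ω → ℝ} (hdm : ∀ n, Measurable (d n)) {D : ℝ}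
    (hd0 : ∀ n ω, 0 ≤ d n ω) (hdD : ∀ n ω, d n ω ≤ D)
    (hd : Tendsto (fun n => ∫ ω, d n ω ∂P) atTop (𝓝 0)) {y : Ω → ℝ} (hy : MemLp y 2 P) :
    Tendsto (fun n => ∫ ω, |y ω| * d n ω ∂P) atTop (𝓝 0) := by
  have hD : 0 ≤ D := by
    obtain ⟨ω⟩ := P.nonempty_of_neZero
    exact (hd0 0 ω).trans (hdD 0 ω)
  have hdi : ∀ n, Integrable (d n) P := fun n =>
    (integrable_const D).mono' (hdm n).aestronglyMeasurable (ae_of_all _ fun ω => by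
      rw [Real.norm_eq_abs, abs_of_nonneg (hd0 n ω)]; exact hdD n ω)
  have hy2 : Integrable (fun ω => y ω ^ 2) P := hy.integrable_sq
  set Y := ∫ ω, y ω ^ 2 ∂P with hY
  have hY0 : 0 ≤ Y := integral_nonneg fun _ => sq_nonneg _
  rw [Metric.tendsto_atTop']
  intro ε hε
  set δ : ℝ := ε / (2 * (Y + 1)) with hδ
  have hδ0 : 0 < δ := by positivity
  have hlim := hd.const_mul (D / δ)
  rw [mul_zero] at hlim
  obtain ⟨N, hN⟩ := eventually_atTop.1 (hlim.eventually (gt_mem_nhds (show 0 < ε / 2 by positivity)))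
  refine ⟨N, fun n hn => ?_⟩
  rw [Real.dist_0_eq_abs, abs_of_nonneg (integral_nonneg fun ω => mul_nonneg (abs_nonneg _) (hd0 n ω))]
  calc ∫ ω, |y ω| * d n ω ∂P ≤ ∫ ω, δ * y ω ^ 2 + D / δ * d n ω ∂P := by
        refine integral_mono_of_nonneg (ae_of_all _ fun ω => mul_nonneg (abs_nonneg _) (hd0 n ω))
          ((hy2.const_mul _).add ((hdi n).const_mul _)) (ae_of_all _ fun ω => ?_)
        simp only
        have h1 : 0 ≤ δ * (|y ω| - d n ω / δ) ^ 2 := by positivity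
        have h2 : δ * (|y ω| - d n ω / δ) ^ 2
            = δ * y ω ^ 2 - 2 * (|y ω| * d n ω) + d n ω ^ 2 / δ := by
          field_simp
          rw [← sq_abs (y ω)]
          ring
        have h3 : d n ω ^ 2 / δ ≤ D / δ * d n ω := by
          rw [sq, mul_div_right_comm]
          gcongr
          · exact hd0 n ω
          · exact hdD n ω
        have h4 := mul_nonneg (abs_nonneg (y ω)) (hd0 n ω)
        linarith
    _ = δ * Y + D / δ * ∫ ω, d n ω ∂P := by
        rw [integral_add (hy2.const_mul _) ((hdi n).const_mul _), integral_const_mul,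
          integral_const_mul]
    _ < ε := by
        have h1 := hN n hn.le
        have h2 : δ * Y ≤ ε / 2 := by
          rw [hδ, div_mul_eq_mul_div, div_le_div_iff₀ (by positivity) (by positivity)]
          nlinarith
        linarith

lemma abs_exp_sub_exp_le {x y B : ℝ} (hx : x ≤ B) (hy : y ≤ B) :
    |Real.exp x - Real.exp y| ≤ Real.exp B * |x - y| := by
  wlog h : y ≤ x generalizing x y
  · rw [abs_sub_comm, abs_sub_comm x]
    exact this hy hx (le_of_not_ge h)
  rw [abs_of_nonneg (sub_nonneg.2 (Real.exp_le_exp.2 h)), abs_of_nonneg (sub_nonneg.2 h)]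
  have h1 := Real.add_one_le_exp (y - x)
  have h2 : Real.exp y = Real.exp x * Real.exp (y - x) := by rw [← Real.exp_add]; ring_nf
  have h3 := Real.exp_le_exp.2 hx
  have h4 := Real.exp_pos x
  rw [h2]
  nlinarith

/-- Stable convergence to a mixture, tested on the trigonometric functionals of the elements of a
class `Ξ`, when the approximating random variables are functionals of finitely many elements of the
class. -/
lemma tendsto_integral_mul_comp_sub_zero {Ω : Type*} [MeasurableSpace Ω] {P : Measure Ω}
    [IsProbabilityMeasure P] {Y V : ℕ → Ω → ℝ} {Q : Ω → ℝ} (hY : ∀ n, Measurable (Y n))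
    (hV : ∀ n, Measurable (V n)) (hQ : Measurable Q) {B : ℝ} (hVB : ∀ n ω, |V n ω| ≤ B)
    (hQB : ∀ ω, |Q ω| ≤ B) (hVQ : Tendsto (fun n => ∫ ω, |V n ω - Q ω| ∂P) atTop (𝓝 0))
    {Ξ : Set (Ω → ℝ)} (hΞ : ∀ ξ ∈ Ξ, Measurable ξ) {ψ : ℝ → ℝ} (hψ : Measurable ψ)
    (hψ1 : ∀ x, |ψ x| ≤ 1) {κ : ℝ} (hκ : |κ| ≤ 1)
    (hcos : ∀ ξ ∈ Ξ, Tendsto (fun n => ∫ ω, Real.cos (ξ ω) *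
      (ψ (Y n ω) * Real.exp (V n ω) - κ) ∂P) atTop (𝓝 0))
    (hsin : ∀ ξ ∈ Ξ, Tendsto (fun n => ∫ ω, Real.sin (ξ ω) *
      (ψ (Y n ω) * Real.exp (V n ω) - κ) ∂P) atTop (𝓝 0))
    (hcomap : ∀ n, n ≠ 0 → ∃ (d : ℕ) (X : Fin d → Ω → ℝ), (∀ i, Measurable (X i)) ∧
      (∀ v : Fin d → ℝ, (fun ω => ∑ i, v i * X i ω) ∈ Ξ) ∧
      Measurable[MeasurableSpace.comap (fun ω i => X i ω) inferInstance] (Y n) ∧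
      Measurable[MeasurableSpace.comap (fun ω i => X i ω) inferInstance] (V n))
    {z : Ω → ℝ} (hz : MemLp z 2 P) :
    Tendsto (fun n => ∫ ω, z ω * (ψ (Y n ω) - κ * Real.exp (-Q ω)) ∂P) atTop (𝓝 0) := by
  have hB : 0 ≤ B := by
    obtain ⟨ω⟩ := P.nonempty_of_neZero
    exact (abs_nonneg _).trans (hQB ω)
  have hQe : ∀ ω, Real.exp (Q ω) ≤ Real.exp B := fun ω =>
    Real.exp_le_exp.2 (abs_le.1 (hQB ω)).2
  have hQe' : ∀ ω, Real.exp (-Q ω) ≤ Real.exp B := fun ω =>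
    Real.exp_le_exp.2 (by linarith [(abs_le.1 (hQB ω)).1])
  have hVe : ∀ n ω, Real.exp (V n ω) ≤ Real.exp B := fun n ω =>
    Real.exp_le_exp.2 (abs_le.1 (hVB n ω)).2
  have hVe' : ∀ n ω, Real.exp (-V n ω) ≤ Real.exp B := fun n ω =>
    Real.exp_le_exp.2 (by linarith [(abs_le.1 (hVB n ω)).1])
  have hψY : ∀ n, Measurable fun ω => ψ (Y n ω) := fun n => hψ.comp (hY n)
  have habs : ∀ n, Measurable fun ω => |V n ω - Q ω| := fun n =>
    ((hV n).sub hQ).abs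
  have habsB : ∀ n ω, |V n ω - Q ω| ≤ 2 * B := fun n ω =>
    (abs_sub _ _).trans (by linarith [hVB n ω, hQB ω])
  have am : ∀ n, Measurable fun ω => ψ (Y n ω) - κ * Real.exp (-Q ω) := fun n =>
    (hψY n).sub (hQ.neg.exp.const_mul κ)
  have ab : ∀ n ω, |ψ (Y n ω) - κ * Real.exp (-Q ω)| ≤ 1 + Real.exp B := fun n ω => by
    refine (abs_sub _ _).trans (add_le_add (hψ1 _) ?_)
    rw [abs_mul, Real.abs_exp]
    exact (mul_le_of_le_one_left (Real.exp_pos _).le hκ).trans (hQe' ω)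
  -- testing against `τ(ξ) e^Q`, for `τ` one of the trigonometric functions
  have htest : ∀ h : Ω → ℝ, Measurable h → (∀ ω, |h ω| ≤ 1) →
      Tendsto (fun n => ∫ ω, h ω * (ψ (Y n ω) * Real.exp (V n ω) - κ) ∂P) atTop (𝓝 0) →
      Tendsto (fun n => ∫ ω, (h ω * Real.exp (Q ω)) *
        (ψ (Y n ω) - κ * Real.exp (-Q ω)) ∂P) atTop (𝓝 0) := fun h hh hh1 hlim => by
    have hbd : Tendsto (fun n => ∫ ω, h ω * ψ (Y n ω) * (Real.exp (Q ω) - Real.exp (V n ω)) ∂P)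
        atTop (𝓝 0) := by
      refine squeeze_zero_norm (a := fun n => ∫ ω, Real.exp B * |V n ω - Q ω| ∂P) (fun n => ?_) ?_
      · refine norm_integral_le_of_norm_le ?_ (ae_of_all _ fun ω => ?_)
        · exact (Integrable.of_bound (habs n).aestronglyMeasurable (2 * B)
            (ae_of_all _ fun ω => by
              rw [Real.norm_eq_abs, abs_abs]; exact habsB n ω)).const_mul _
        · rw [Real.norm_eq_abs, abs_mul, abs_mul, abs_sub_comm (V n ω)]
          refine (mul_le_of_le_one_left (abs_nonneg _)
            (mul_le_one₀ (hh1 ω) (abs_nonneg _) (hψ1 _))).trans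
            (abs_exp_sub_exp_le (abs_le.1 (hQB ω)).2 (abs_le.1 (hVB n ω)).2)
      · simpa [integral_const_mul] using hVQ.const_mul (Real.exp B)
    have := hlim.add hbd
    rw [add_zero] at this
    refine this.congr fun n => ?_
    rw [← integral_add]
    · refine integral_congr_ae (ae_of_all _ fun ω => ?_)
      simp only
      have : Real.exp (Q ω) * Real.exp (-Q ω) = 1 := by rw [← Real.exp_add]; simp
      linear_combination κ * h ω * this
    · refine Integrable.of_bound (C := Real.exp B + 1)
        (hh.mul (((hψY n).mul (hV n).exp).sub_const κ)).aestronglyMeasurable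
        (ae_of_all _ fun ω => ?_)
      rw [Real.norm_eq_abs, abs_mul]
      refine (mul_le_of_le_one_left (abs_nonneg _) (hh1 ω)).trans
        ((abs_sub _ _).trans (add_le_add ?_ hκ))
      rw [abs_mul, Real.abs_exp]
      exact (mul_le_of_le_one_left (Real.exp_pos _).le (hψ1 _)).trans (hVe n ω)
    · refine Integrable.of_bound (C := Real.exp B + Real.exp B)
        ((hh.mul (hψY n)).mul (hQ.exp.sub (hV n).exp)).aestronglyMeasurable
        (ae_of_all _ fun ω => ?_)
      rw [Real.norm_eq_abs, abs_mul, abs_mul]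
      refine (mul_le_of_le_one_left (abs_nonneg _)
        (mul_le_one₀ (hh1 ω) (abs_nonneg _) (hψ1 _))).trans
        ((abs_sub _ _).trans (add_le_add ?_ ?_))
      · rw [Real.abs_exp]; exact hQe ω
      · rw [Real.abs_exp]; exact hVe n ω
  have hL2 : ∀ h : Ω → ℝ, Measurable h → (∀ ω, |h ω| ≤ 1) →
      MemLp (fun ω => h ω * Real.exp (Q ω)) 2 P := fun h hh hh1 =>
    MemLp.of_bound (hh.mul hQ.exp).aestronglyMeasurable (Real.exp B) (ae_of_all _ fun ω => by
      rw [Real.norm_eq_abs, abs_mul, Real.abs_exp]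
      exact (mul_le_of_le_one_left (Real.exp_pos _).le (hh1 ω)).trans (hQe ω))
  refine tendsto_integral_mul_zero_of_orthogonal am ab
    (A := {x | ∃ ξ ∈ Ξ, x = (fun ω => Real.cos (ξ ω) * Real.exp (Q ω)) ∨
      x = fun ω => Real.sin (ξ ω) * Real.exp (Q ω)}) ?_ ?_ ?_ hz
  · rintro x ⟨ξ, hξ, rfl | rfl⟩
    · exact hL2 _ (hΞ ξ hξ).cos fun _ => Real.abs_cos_le_one _
    · exact hL2 _ (hΞ ξ hξ).sin fun _ => Real.abs_sin_le_one _
  · rintro x ⟨ξ, hξ, rfl | rfl⟩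
    · exact htest _ (hΞ ξ hξ).cos (fun _ => Real.abs_cos_le_one _) (hcos ξ hξ)
    · exact htest _ (hΞ ξ hξ).sin (fun _ => Real.abs_sin_le_one _) (hsin ξ hξ)
  · intro y hy hyA
    have hy1 : Integrable y P := hy.integrable one_le_two
    have hηi : Integrable (fun ω => y ω * Real.exp (Q ω)) P :=
      hy1.mul_bdd hQ.exp.aestronglyMeasurable (ae_of_all _ fun ω => by
        rw [Real.norm_eq_abs, Real.abs_exp]; exact hQe ω)
    let G : ℕ → Ω → ℝ := fun n ω =>
      ψ (Y n ω) * Real.exp (-V n ω) - κ * (Real.exp (-V n ω) * Real.exp (-V n ω))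
    have hGm : ∀ n, Measurable (G n) := fun n =>
      ((hψY n).mul (hV n).neg.exp).sub (((hV n).neg.exp.mul (hV n).neg.exp).const_mul κ)
    have hGb : ∀ n ω, |G n ω| ≤ Real.exp B + Real.exp B * Real.exp B := fun n ω => by
      refine (abs_sub _ _).trans (add_le_add ?_ ?_)
      · rw [abs_mul, Real.abs_exp]
        exact (mul_le_of_le_one_left (Real.exp_pos _).le (hψ1 _)).trans (hVe' n ω)
      · rw [abs_mul, abs_mul, Real.abs_exp]
        exact (mul_le_of_le_one_left (by positivity) hκ).trans
          (mul_le_mul (hVe' n ω) (hVe' n ω) (Real.exp_pos _).le (Real.exp_pos _).le)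
    have hG0 : ∀ n, n ≠ 0 → ∫ ω, (y ω * Real.exp (Q ω)) * G n ω ∂P = 0 := fun n hn => by
      obtain ⟨d, X, hXm, hXΞ, hYX, hVX⟩ := hcomap n hn
      refine integral_mul_eq_zero_of_integral_mul_cexp hXm hηi (fun v => ?_) (fun v => ?_) ?_
        (hGb n)
      · rw [← hyA _ ⟨_, hXΞ v, Or.inl rfl⟩]
        exact integral_congr_ae (ae_of_all _ fun ω => by simp only; ring)
      · rw [← hyA _ ⟨_, hXΞ v, Or.inr rfl⟩]
        exact integral_congr_ae (ae_of_all _ fun ω => by simp only; ring)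
      · exact ((hψ.comp hYX).mul hVX.neg.exp).sub ((hVX.neg.exp.mul hVX.neg.exp).const_mul κ)
    set L : ℝ := Real.exp B * Real.exp B + Real.exp B * ((Real.exp B + Real.exp B) *
      Real.exp B) with hL
    have hdiff : ∀ n ω, |(ψ (Y n ω) - κ * Real.exp (-Q ω)) - Real.exp (Q ω) * G n ω| ≤
        L * |V n ω - Q ω| := fun n ω => by
      have h1 : Real.exp (Q ω) * Real.exp (-Q ω) = 1 := by rw [← Real.exp_add]; simp
      have h2 : |Real.exp (-Q ω) - Real.exp (-V n ω)| ≤ Real.exp B * |V n ω - Q ω| := by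
        have := abs_exp_sub_exp_le (x := -Q ω) (y := -V n ω) (B := B)
          (by linarith [(abs_le.1 (hQB ω)).1]) (by linarith [(abs_le.1 (hVB n ω)).1])
        rwa [neg_sub_neg] at this
      have h3 : (ψ (Y n ω) - κ * Real.exp (-Q ω)) - Real.exp (Q ω) * G n ω =
          ψ (Y n ω) * (Real.exp (Q ω) * (Real.exp (-Q ω) - Real.exp (-V n ω))) -
          κ * (Real.exp (Q ω) * ((Real.exp (-Q ω) + Real.exp (-V n ω)) *
            (Real.exp (-Q ω) - Real.exp (-V n ω)))) := by
        simp only [G]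
        linear_combination (κ * Real.exp (-Q ω) - ψ (Y n ω)) * h1
      rw [h3, hL, add_mul (Real.exp B * Real.exp B)]
      refine (abs_sub _ _).trans (add_le_add ?_ ?_)
      · rw [abs_mul, abs_mul, Real.abs_exp, mul_assoc]
        exact (mul_le_of_le_one_left (by positivity) (hψ1 _)).trans
          (mul_le_mul (hQe ω) h2 (abs_nonneg _) (Real.exp_pos _).le)
      · rw [abs_mul, abs_mul, abs_mul, Real.abs_exp, mul_assoc (Real.exp B),
          mul_assoc (Real.exp B + Real.exp B)]
        refine (mul_le_of_le_one_left (by positivity) hκ).trans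
          (mul_le_mul (hQe ω) (mul_le_mul ?_ h2 (abs_nonneg _) (by positivity)) (by positivity)
            (Real.exp_pos _).le)
        rw [abs_of_nonneg (by positivity)]
        exact add_le_add (hQe' ω) (hVe' n ω)
    have hlim := (tendsto_integral_abs_mul_of_bounded habs (fun _ _ => abs_nonneg _) habsB hVQ
      hy).const_mul L
    rw [mul_zero] at hlim
    refine squeeze_zero_norm' ?_ hlim
    filter_upwards [eventually_ne_atTop 0] with n hn
    have e : ∫ ω, y ω * (ψ (Y n ω) - κ * Real.exp (-Q ω)) ∂P =
        ∫ ω, y ω * ((ψ (Y n ω) - κ * Real.exp (-Q ω)) - Real.exp (Q ω) * G n ω) ∂P := by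
      rw [← sub_zero (∫ ω, y ω * (ψ (Y n ω) - κ * Real.exp (-Q ω)) ∂P), ← hG0 n hn,
        ← integral_sub]
      · exact integral_congr_ae (ae_of_all _ fun ω => by simp only; ring)
      · exact hy1.mul_bdd (am n).aestronglyMeasurable (ae_of_all _ (ab n))
      · exact hηi.mul_bdd (hGm n).aestronglyMeasurable (ae_of_all _ (hGb n))
    rw [e, ← integral_const_mul]
    refine norm_integral_le_of_norm_le ?_ (ae_of_all _ fun ω => ?_)
    · exact (hy1.abs.mul_bdd (habs n).aestronglyMeasurable (c := 2 * B) (ae_of_all _ fun ω => by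
        rw [Real.norm_eq_abs, abs_abs]; exact habsB n ω)).const_mul _
    · rw [Real.norm_eq_abs, abs_mul, mul_left_comm]
      exact mul_le_mul_of_nonneg_left (hdiff n ω) (abs_nonneg _)

lemma measurable_gridSum {Ω : Type*} [MeasurableSpace Ω] {W : ℝ × ℝ → Ω → ℝ} {g : ℝ → ℝ}
    (hg : Measurable g) {n : ℕ}
    (hW : ∀ i ≤ n, ∀ j ≤ n, Measurable (W ((i : ℝ) / n, (j : ℝ) / n))) {p : ℝ × ℝ}
    (hp : p ≤ (1, 1)) : Measurable (gridSum W g n p) :=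
  Finset.measurable_fun_sum _ fun _ hi => Finset.measurable_fun_sum _ fun _ hj =>
    (hg.comp (hW _ ((Finset.mem_range.1 hi).le.trans (floor_mul_le hp.1)) _
      ((Finset.mem_range.1 hj).le.trans (floor_mul_le hp.2)))).mul_const _

lemma measurable_wqv {Ω : Type*} [MeasurableSpace Ω] {W : ℝ × ℝ → Ω → ℝ} {f : ℝ → ℝ}
    (hf : Measurable f) {n : ℕ}
    (hW : ∀ i ≤ n, ∀ j ≤ n, Measurable (W ((i : ℝ) / n, (j : ℝ) / n))) {p : ℝ × ℝ}
    (hp : p ≤ (1, 1)) : Measurable (wqv W f n p.1 p.2) := by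
  rcases eq_or_ne n 0 with rfl | hn
  · have : wqv W f 0 p.1 p.2 = fun _ => 0 := funext fun ω => by simp [wqv]
    rw [this]
    exact measurable_const
  have : wqv W f n p.1 p.2 = _ := funext (wqv_eq_sum_range W f hn p.1 p.2)
  rw [this]
  refine Finset.measurable_fun_sum _ fun i hi => Finset.measurable_fun_sum _ fun j hj => ?_
  have hi' : i < n := (Finset.mem_range.1 hi).trans_le (floor_mul_le hp.1)
  have hj' : j < n := (Finset.mem_range.1 hj).trans_le (floor_mul_le hp.2)
  have hc : Measurable (cellIncrement W n i j) :=
    measurable_cellIncrement (hW _ hi'.le _ hj'.le) (hW _ hi' _ hj') (hW _ hi'.le _ hj')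
      (hW _ hi' _ hj'.le)
  exact ((hf.comp (hW _ hi'.le _ hj'.le)).mul ((hc.pow_const 2).sub_const 1)).mul_const _

lemma abs_gridSum_le {Ω : Type*} (W : ℝ × ℝ → Ω → ℝ) {g : ℝ → ℝ} {D : ℝ} (hgD : ∀ x, |g x| ≤ D)
    (n : ℕ) {p : ℝ × ℝ} (hp : p ≤ (1, 1)) (ω : Ω) : |gridSum W g n p ω| ≤ D := by
  have hD : 0 ≤ D := (abs_nonneg _).trans (hgD 0)
  rcases eq_or_ne n 0 with rfl | hn
  · simpa [gridSum]
  have hn' : (0 : ℝ) < n := by exact_mod_cast Nat.pos_of_ne_zero hn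
  have h1 : (Nat.floor ((n : ℝ) * p.1) : ℝ) ≤ n := by exact_mod_cast floor_mul_le hp.1
  have h2 : (Nat.floor ((n : ℝ) * p.2) : ℝ) ≤ n := by exact_mod_cast floor_mul_le hp.2
  calc |gridSum W g n p ω|
      ≤ ∑ i ∈ Finset.range (Nat.floor ((n : ℝ) * p.1)),
          ∑ j ∈ Finset.range (Nat.floor ((n : ℝ) * p.2)), D * (1 / n) ^ 2 := by
        refine (Finset.abs_sum_le_sum_abs _ _).trans (Finset.sum_le_sum fun i _ =>
          (Finset.abs_sum_le_sum_abs _ _).trans (Finset.sum_le_sum fun j _ => ?_))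
        rw [abs_mul, abs_of_nonneg (by positivity : (0 : ℝ) ≤ (1 / n) ^ 2)]
        exact mul_le_mul_of_nonneg_right (hgD _) (by positivity)
    _ = Nat.floor ((n : ℝ) * p.1) * (Nat.floor ((n : ℝ) * p.2) * (D * (1 / n) ^ 2)) := by
        simp
    _ ≤ n * (n * (D * (1 / n) ^ 2)) := by gcongr
    _ = D := by field_simp

lemma abs_setIntegral_comp_le {Ω : Type*} (W : ℝ × ℝ → Ω → ℝ) {g : ℝ → ℝ} {D : ℝ}
    (hgD : ∀ x, |g x| ≤ D) {p : ℝ × ℝ} (hp : p ∈ Set.Icc ((0:ℝ), (0:ℝ)) (1, 1)) (ω : Ω) :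
    |∫ ρ in Set.Icc 0 p.1 ×ˢ Set.Icc 0 p.2, g (W ρ ω)| ≤ D := by
  have hD : 0 ≤ D := (abs_nonneg _).trans (hgD 0)
  have hvol : volume.real (Set.Icc 0 p.1 ×ˢ Set.Icc 0 p.2) = p.1 * p.2 := by
    rw [Measure.real, Measure.volume_eq_prod, Measure.prod_prod, Real.volume_Icc, Real.volume_Icc,
      ENNReal.toReal_mul, sub_zero, sub_zero, ENNReal.toReal_ofReal hp.1.1,
      ENNReal.toReal_ofReal hp.1.2]
  refine (norm_setIntegral_le_of_norm_le_const (f := fun ρ => g (W ρ ω)) (C := D) ?_ fun ρ _ => hgD _).trans ?_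
  · rw [Measure.volume_eq_prod, Measure.prod_prod]
    simp [ENNReal.mul_lt_top]
  · rw [hvol]
    exact mul_le_of_le_one_right hD (mul_le_one₀ hp.2.1 hp.1.2 hp.2.2)

lemma integrable_cexp_mul {Ω : Type*} [MeasurableSpace Ω] {P : Measure Ω} {ξ : Ω → ℝ}
    (hξ : Measurable ξ) {H : Ω → ℂ} (hH : Integrable H P) :
    Integrable (fun ω => Complex.exp (Complex.I * (ξ ω : ℂ)) * H ω) P :=
  hH.bdd_mul (c := 1) (by fun_prop : Measurable fun ω =>
    Complex.exp (Complex.I * (ξ ω : ℂ))).aestronglyMeasurable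
    (ae_of_all _ fun ω => (norm_cexp_I_mul_ofReal _).le)

lemma tendsto_integral_cos_mul {Ω : Type*} [MeasurableSpace Ω] {P : Measure Ω} {ξ : Ω → ℝ}
    (hξ : Measurable ξ) {H : ℕ → Ω → ℂ} (hH : ∀ n, Integrable (H n) P)
    (h1 : Tendsto (fun n => ∫ ω, Complex.exp (Complex.I * (ξ ω : ℂ)) * H n ω ∂P) atTop (𝓝 0))
    (h2 : Tendsto (fun n => ∫ ω, Complex.exp (Complex.I * ((-ξ ω : ℝ) : ℂ)) * H n ω ∂P)
      atTop (𝓝 0)) :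
    Tendsto (fun n => ∫ ω, (Real.cos (ξ ω) : ℂ) * H n ω ∂P) atTop (𝓝 0) := by
  have h := (h1.add h2).const_mul (1 / 2)
  rw [add_zero, mul_zero] at h
  refine h.congr fun n => ?_
  rw [← integral_add (integrable_cexp_mul hξ (hH n)) (integrable_cexp_mul (ξ := fun ω => -ξ ω) hξ.neg (hH n)),
    ← integral_const_mul]
  refine integral_congr_ae (ae_of_all _ fun ω => ?_)
  simp only [Complex.ofReal_cos, Complex.cos, Complex.ofReal_neg]
  ring_nf

lemma tendsto_integral_sin_mul {Ω : Type*} [MeasurableSpace Ω] {P : Measure Ω} {ξ : Ω → ℝ}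
    (hξ : Measurable ξ) {H : ℕ → Ω → ℂ} (hH : ∀ n, Integrable (H n) P)
    (h1 : Tendsto (fun n => ∫ ω, Complex.exp (Complex.I * (ξ ω : ℂ)) * H n ω ∂P) atTop (𝓝 0))
    (h2 : Tendsto (fun n => ∫ ω, Complex.exp (Complex.I * ((-ξ ω : ℝ) : ℂ)) * H n ω ∂P)
      atTop (𝓝 0)) :
    Tendsto (fun n => ∫ ω, (Real.sin (ξ ω) : ℂ) * H n ω ∂P) atTop (𝓝 0) := by
  have h := (h2.sub h1).const_mul (Complex.I / 2)
  rw [sub_zero, mul_zero] at h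
  refine h.congr fun n => ?_
  rw [← integral_sub (integrable_cexp_mul (ξ := fun ω => -ξ ω) hξ.neg (hH n)) (integrable_cexp_mul hξ (hH n)),
    ← integral_const_mul]
  refine integral_congr_ae (ae_of_all _ fun ω => ?_)
  simp only [Complex.ofReal_sin, Complex.sin, Complex.ofReal_neg]
  ring_nf

lemma Filter.Tendsto.integral_ofReal_mul_re {Ω : Type*} [MeasurableSpace Ω] {P : Measure Ω}
    {h : Ω → ℝ} (hh : Measurable h) (hh1 : ∀ ω, |h ω| ≤ 1) {H : ℕ → Ω → ℂ}
    (hH : ∀ n, Integrable (H n) P)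
    (hlim : Tendsto (fun n => ∫ ω, (h ω : ℂ) * H n ω ∂P) atTop (𝓝 0)) :
    Tendsto (fun n => ∫ ω, h ω * (H n ω).re ∂P) atTop (𝓝 0) := by
  have := (Complex.continuous_re.tendsto 0).comp hlim
  rw [Complex.zero_re] at this
  refine this.congr fun n => ?_
  have hi : Integrable (fun ω => (h ω : ℂ) * H n ω) P :=
    (hH n).bdd_mul (c := 1) (Complex.measurable_ofReal.comp hh).aestronglyMeasurable
      (ae_of_all _ fun ω => by simpa using hh1 ω)
  have e := Complex.reCLM.integral_comp_comm hi
  simp only [Complex.reCLM_apply, Complex.re_ofReal_mul] at e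
  exact e.symm

lemma Filter.Tendsto.integral_ofReal_mul_im {Ω : Type*} [MeasurableSpace Ω] {P : Measure Ω}
    {h : Ω → ℝ} (hh : Measurable h) (hh1 : ∀ ω, |h ω| ≤ 1) {H : ℕ → Ω → ℂ}
    (hH : ∀ n, Integrable (H n) P)
    (hlim : Tendsto (fun n => ∫ ω, (h ω : ℂ) * H n ω ∂P) atTop (𝓝 0)) :
    Tendsto (fun n => ∫ ω, h ω * (H n ω).im ∂P) atTop (𝓝 0) := by
  have := (Complex.continuous_im.tendsto 0).comp hlim
  rw [Complex.zero_im] at this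
  refine this.congr fun n => ?_
  have hi : Integrable (fun ω => (h ω : ℂ) * H n ω) P :=
    (hH n).bdd_mul (c := 1) (Complex.measurable_ofReal.comp hh).aestronglyMeasurable
      (ae_of_all _ fun ω => by simpa using hh1 ω)
  have e := Complex.imCLM.integral_comp_comm hi
  simp only [Complex.imCLM_apply, Complex.im_ofReal_mul] at e
  exact e.symm

/-- Replacing a convergent phase by its limit. -/
lemma tendsto_integral_cexp_mul_of_tendsto {Ω : Type*} [MeasurableSpace Ω] {P : Measure Ω}
    [IsFiniteMeasure P] {ξ : ℕ → Ω → ℝ} {ξ' : Ω → ℝ} (hξ : ∀ n, Measurable (ξ n))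
    (hξ' : Measurable ξ') (hlim : ∀ ω, Tendsto (fun n => ξ n ω) atTop (𝓝 (ξ' ω)))
    {H : ℕ → Ω → ℂ} (hH : ∀ n, Measurable (H n)) {D : ℝ} (hD : ∀ n ω, ‖H n ω‖ ≤ D)
    (h : Tendsto (fun n => ∫ ω, Complex.exp (Complex.I * (ξ n ω : ℂ)) * H n ω ∂P) atTop (𝓝 0)) :
    Tendsto (fun n => ∫ ω, Complex.exp (Complex.I * (ξ' ω : ℂ)) * H n ω ∂P) atTop (𝓝 0) := by
  have hHi : ∀ n, Integrable (H n) P := fun n =>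
    Integrable.of_bound (hH n).aestronglyMeasurable D (ae_of_all _ (hD n))
  have hm : ∀ n, Measurable fun ω => Complex.exp (Complex.I * (ξ n ω : ℂ)) := fun n => by
    have := hξ n
    fun_prop
  have hm' : Measurable fun ω => Complex.exp (Complex.I * (ξ' ω : ℂ)) := by fun_prop
  have h0 : Tendsto (fun n => ∫ ω, (Complex.exp (Complex.I * (ξ' ω : ℂ)) -
      Complex.exp (Complex.I * (ξ n ω : ℂ))) * H n ω ∂P) atTop (𝓝 (∫ _, 0 ∂P)) := by
    refine tendsto_integral_of_dominated_convergence (fun _ => 2 * D)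
      (fun n => ((hm'.sub (hm n)).mul (hH n)).aestronglyMeasurable) (integrable_const _)
      (fun n => ae_of_all _ fun ω => ?_) (ae_of_all _ fun ω => ?_)
    · rw [norm_mul]
      refine mul_le_mul ((norm_sub_le _ _).trans ?_) (hD n ω) (norm_nonneg _) zero_le_two
      rw [norm_cexp_I_mul_ofReal, norm_cexp_I_mul_ofReal]
      norm_num
    · have hc : Continuous fun x : ℝ => Complex.exp (Complex.I * (ξ' ω : ℂ)) -
          Complex.exp (Complex.I * (x : ℂ)) := by fun_prop
      have h1 := (hc.tendsto (ξ' ω)).comp (hlim ω)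
      simp only [sub_self] at h1
      have h2 : Tendsto (fun n => ‖Complex.exp (Complex.I * (ξ' ω : ℂ)) -
          Complex.exp (Complex.I * (ξ n ω : ℂ))‖ * D) atTop (𝓝 0) := by
        simpa using h1.norm.mul_const D
      refine squeeze_zero_norm (fun n => ?_) h2
      rw [norm_mul]
      exact mul_le_mul_of_nonneg_left (hD n ω) (norm_nonneg _)
  have := h0.add h
  rw [integral_zero, add_zero] at this
  refine this.congr fun n => ?_
  rw [← integral_add _ (integrable_cexp_mul (hξ n) (hHi n))]
  · exact integral_congr_ae (ae_of_all _ fun ω => by simp only; ring)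
  · simp_rw [sub_mul]
    exact (integrable_cexp_mul hξ' (hHi n)).sub (integrable_cexp_mul (hξ n) (hHi n))

namespace IsBrownianSheet

variable {Ω : Type*} [MeasurableSpace Ω] {P : Measure Ω} {W : ℝ × ℝ → Ω → ℝ}

/-- Stable convergence of the weighted quadratic variations when all the paths are continuous. -/
lemma tendsto_integral_mul_cexp_wqv (hW : IsBrownianSheet P W) [IsProbabilityMeasure P]
    (hWc : ∀ ω, Continuous fun z => W z ω) {f : ℝ → ℝ} (hf : Measurable f) {C : ℝ}
    (hfC : ∀ x, |f x| ≤ C) {κ : Type*} [Fintype κ] {z : κ → ℝ × ℝ}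
    (hz : ∀ k, z k ∈ Set.Icc ((0:ℝ), (0:ℝ)) (1, 1)) (u : κ → ℝ) {Z : Ω → ℝ} (hZ : MemLp Z 2 P) :
    Tendsto (fun n : ℕ => ∫ ω, (Z ω : ℂ) *
        Complex.exp (Complex.I * ((∑ k, u k * wqv W f n (z k).1 (z k).2 ω : ℝ) : ℂ)) ∂P) atTop
      (𝓝 (∫ ω, (Z ω : ℂ) * Complex.exp (-((∑ q : κ × κ, u q.1 * u q.2 *
        ∫ ρ in Set.Icc 0 (min (z q.1).1 (z q.2).1) ×ˢ Set.Icc 0 (min (z q.1).2 (z q.2).2),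
          f (W ρ ω) ^ 2 : ℝ) : ℂ)) ∂P)) := by
  let r : κ × κ → ℝ × ℝ := fun q => (min (z q.1).1 (z q.2).1, min (z q.1).2 (z q.2).2)
  have hr : ∀ q, r q ∈ Set.Icc ((0:ℝ), (0:ℝ)) (1, 1) := fun q =>
    ⟨⟨le_min (hz q.1).1.1 (hz q.2).1.1, le_min (hz q.1).1.2 (hz q.2).1.2⟩,
      ⟨(min_le_left _ _).trans (hz q.1).2.1, (min_le_left _ _).trans (hz q.1).2.2⟩⟩
  have hg : Measurable fun x => f x ^ 2 := hf.pow_const 2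
  have hgC : ∀ x, |f x ^ 2| ≤ C ^ 2 := fun x => by
    rw [abs_pow]
    exact pow_le_pow_left₀ (abs_nonneg _) (hfC x) 2
  let Y : ℕ → Ω → ℝ := fun n ω => ∑ k, u k * wqv W f n (z k).1 (z k).2 ω
  let V : ℕ → Ω → ℝ := fun n ω =>
    ∑ q : κ × κ, u q.1 * u q.2 * gridSum W (fun x => f x ^ 2) n (r q) ω
  let Q : Ω → ℝ := fun ω => ∑ q : κ × κ, u q.1 * u q.2 *
    ∫ ρ in Set.Icc 0 (r q).1 ×ˢ Set.Icc 0 (r q).2, f (W ρ ω) ^ 2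
  set B : ℝ := ∑ q : κ × κ, |u q.1 * u q.2| * C ^ 2 with hB
  have hYm' : ∀ (n : ℕ) (m : MeasurableSpace Ω),
      (∀ i ≤ n, ∀ j ≤ n, Measurable[m] (W ((i : ℝ) / n, (j : ℝ) / n))) → Measurable[m] (Y n) :=
    fun n m h => Finset.measurable_fun_sum _ fun k _ =>
      (measurable_wqv hf h (hz k).2).const_mul _
  have hVm' : ∀ (n : ℕ) (m : MeasurableSpace Ω),
      (∀ i ≤ n, ∀ j ≤ n, Measurable[m] (W ((i : ℝ) / n, (j : ℝ) / n))) → Measurable[m] (V n) :=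
    fun n m h => Finset.measurable_fun_sum _ fun q _ =>
      (measurable_gridSum hg h (hr q).2).const_mul _
  have hY : ∀ n, Measurable (Y n) := fun n => hYm' n _ fun _ _ _ _ => hW.1 _
  have hV : ∀ n, Measurable (V n) := fun n => hVm' n _ fun _ _ _ _ => hW.1 _
  have hI : ∀ q, Measurable fun ω =>
      ∫ ρ in Set.Icc 0 (r q).1 ×ˢ Set.Icc 0 (r q).2, f (W ρ ω) ^ 2 := fun q =>
    (StronglyMeasurable.integral_prod_right' (f := fun x : Ω × (ℝ × ℝ) => f (W x.2 x.1) ^ 2)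
      (hg.comp ((hW.measurable_uncurry hWc).comp measurable_swap)).stronglyMeasurable).measurable
  have hQ : Measurable Q := Finset.measurable_fun_sum _ fun q _ => (hI q).const_mul _
  have hVB : ∀ n ω, |V n ω| ≤ B := fun n ω =>
    (Finset.abs_sum_le_sum_abs _ _).trans <| Finset.sum_le_sum fun q _ => by
      rw [abs_mul]
      exact mul_le_mul_of_nonneg_left (abs_gridSum_le W hgC n (hr q).2 ω) (abs_nonneg _)
  have hQB : ∀ ω, |Q ω| ≤ B := fun ω =>
    (Finset.abs_sum_le_sum_abs _ _).trans <| Finset.sum_le_sum fun q _ => by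
      rw [abs_mul]
      exact mul_le_mul_of_nonneg_left (abs_setIntegral_comp_le W hgC (hr q) ω) (abs_nonneg _)
  have hVQ : Tendsto (fun n => ∫ ω, |V n ω - Q ω| ∂P) atTop (𝓝 0) := by
    have hdi : ∀ q n, Integrable (fun ω => |u q.1 * u q.2| *
        |gridSum W (fun x => f x ^ 2) n (r q) ω -
          ∫ ρ in Set.Icc 0 (r q).1 ×ˢ Set.Icc 0 (r q).2, f (W ρ ω) ^ 2|) P := fun q n =>
      (Integrable.of_bound (C := C ^ 2 + C ^ 2) ((measurable_gridSum hg (fun _ _ _ _ => hW.1 _)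
        (hr q).2).sub (hI q)).abs.aestronglyMeasurable (ae_of_all _ fun ω => by
          rw [Real.norm_eq_abs, abs_abs]
          exact (abs_sub _ _).trans (add_le_add (abs_gridSum_le W hgC n (hr q).2 ω)
            (abs_setIntegral_comp_le W hgC (hr q) ω)))).const_mul _
    have hlim : Tendsto (fun n => ∑ q : κ × κ, |u q.1 * u q.2| *
        ∫ ω, |gridSum W (fun x => f x ^ 2) n (r q) ω -
          ∫ ρ in Set.Icc 0 (r q).1 ×ˢ Set.Icc 0 (r q).2, f (W ρ ω) ^ 2| ∂P) atTop (𝓝 0) := by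
      have := tendsto_finsetSum (Finset.univ : Finset (κ × κ)) fun q _ =>
        (hW.tendsto_integral_abs_gridSum_sub hWc hg hgC (hr q)).const_mul |u q.1 * u q.2|
      simpa using this
    refine squeeze_zero (fun n => integral_nonneg fun ω => abs_nonneg _) (fun n => ?_) hlim
    simp_rw [← integral_const_mul]
    rw [← integral_finsetSum _ fun q _ => hdi q n]
    refine integral_mono_of_nonneg (ae_of_all _ fun ω => abs_nonneg _)
      (integrable_finsetSum _ fun q _ => hdi q n) (ae_of_all _ fun ω => ?_)
    simp only [V, Q, ← Finset.sum_sub_distrib, ← mul_sub]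
    exact (Finset.abs_sum_le_sum_abs _ _).trans (Finset.sum_le_sum fun q _ => (abs_mul _ _).le)
  let Ξ : Set (Ω → ℝ) := {ξ | ∃ (d : ℕ) (p : Fin d → ℝ × ℝ) (v : Fin d → ℝ),
    (∀ l, p l ∈ Set.Icc ((0:ℝ), (0:ℝ)) (1, 1)) ∧ ξ = fun ω => ∑ l, v l * W (p l) ω}
  have hΞ : ∀ ξ ∈ Ξ, Measurable ξ := by
    rintro _ ⟨d, p, v, -, rfl⟩
    exact Finset.measurable_fun_sum _ fun l _ => (hW.1 _).const_mul _
  have hΞneg : ∀ ξ ∈ Ξ, (fun ω => -ξ ω) ∈ Ξ := by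
    rintro _ ⟨d, p, v, hp, rfl⟩
    exact ⟨d, p, fun l => -v l, hp, funext fun ω => by simp⟩
  let H : ℕ → Ω → ℂ := fun n ω =>
    Complex.exp (Complex.I * (Y n ω : ℂ)) * (Real.exp (V n ω) : ℂ) - 1
  have hHm : ∀ n, Measurable (H n) := fun n => by
    have h1 := hY n
    have h2 := hV n
    exact ((by fun_prop : Measurable fun ω => Complex.exp (Complex.I * (Y n ω : ℂ))).mul
      (Complex.measurable_ofReal.comp h2.exp)).sub_const 1
  have hHB : ∀ n ω, ‖H n ω‖ ≤ Real.exp B + 1 := fun n ω => by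
    refine (norm_sub_le _ _).trans (add_le_add ?_ (by simp))
    rw [norm_mul, norm_cexp_I_mul_ofReal, one_mul, Complex.norm_real, Real.norm_eq_abs,
      Real.abs_exp]
    exact Real.exp_le_exp.2 (abs_le.1 (hVB n ω)).2
  have hHi : ∀ n, Integrable (H n) P := fun n =>
    Integrable.of_bound (hHm n).aestronglyMeasurable _ (ae_of_all _ (hHB n))
  have hHre : ∀ n ω, (H n ω).re = Real.cos (Y n ω) * Real.exp (V n ω) - 1 := fun n ω => by
    simp [H, Complex.exp_re, -Complex.ofReal_exp]
  have hHim : ∀ n ω, (H n ω).im = Real.sin (Y n ω) * Real.exp (V n ω) - 0 := fun n ω => by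
    simp [H, Complex.exp_im, -Complex.ofReal_exp]
  have hphase : ∀ ξ ∈ Ξ, Tendsto (fun n => ∫ ω, Complex.exp (Complex.I * (ξ ω : ℂ)) * H n ω ∂P)
      atTop (𝓝 0) := by
    rintro _ ⟨d, p, v, hp, rfl⟩
    refine tendsto_integral_cexp_mul_of_tendsto
      (ξ := fun n ω => ∑ l, v l * W (gridPoint n (p l)) ω)
      (fun n => Finset.measurable_fun_sum _ fun l _ => (hW.1 _).const_mul _)
      (Finset.measurable_fun_sum _ fun l _ => (hW.1 _).const_mul _)
      (fun ω => tendsto_finsetSum _ fun l _ =>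
        (((hWc ω).tendsto (p l)).comp (tendsto_gridPoint (hp l))).const_mul _) hHm hHB
      (hW.tendsto_integral_cexp_mul hf hfC hp v hz u)
  have hcos : ∀ ξ ∈ Ξ, Tendsto (fun n => ∫ ω, (Real.cos (ξ ω) : ℂ) * H n ω ∂P) atTop (𝓝 0) :=
    fun ξ hξ => tendsto_integral_cos_mul (hΞ ξ hξ) hHi (hphase ξ hξ) (hphase _ (hΞneg ξ hξ))
  have hsin : ∀ ξ ∈ Ξ, Tendsto (fun n => ∫ ω, (Real.sin (ξ ω) : ℂ) * H n ω ∂P) atTop (𝓝 0) :=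
    fun ξ hξ => tendsto_integral_sin_mul (hΞ ξ hξ) hHi (hphase ξ hξ) (hphase _ (hΞneg ξ hξ))
  have hcomap : ∀ n, n ≠ 0 → ∃ (d : ℕ) (X : Fin d → Ω → ℝ), (∀ i, Measurable (X i)) ∧
      (∀ v : Fin d → ℝ, (fun ω => ∑ i, v i * X i ω) ∈ Ξ) ∧
      Measurable[MeasurableSpace.comap (fun ω i => X i ω) inferInstance] (Y n) ∧
      Measurable[MeasurableSpace.comap (fun ω i => X i ω) inferInstance] (V n) := fun n _ => by
    let e := finProdFinEquiv (m := n + 1) (n := n + 1)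
    let p : Fin ((n + 1) * (n + 1)) → ℝ × ℝ := fun l =>
      (((e.symm l).1 : ℕ) / n, ((e.symm l).2 : ℕ) / n)
    let X : Fin ((n + 1) * (n + 1)) → Ω → ℝ := fun l => W (p l)
    have hX : ∀ i ≤ n, ∀ j ≤ n,
        Measurable[MeasurableSpace.comap (fun ω l => X l ω) inferInstance]
          (W ((i : ℝ) / n, (j : ℝ) / n)) := fun i hi j hj => by
      have h1 : W ((i : ℝ) / n, (j : ℝ) / n) = (fun x : Fin ((n + 1) * (n + 1)) → ℝ =>
          x (e (⟨i, Nat.lt_succ_of_le hi⟩, ⟨j, Nat.lt_succ_of_le hj⟩))) ∘ fun ω l => X l ω := by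
        ext ω
        simp [X, p]
      rw [h1]
      exact (measurable_pi_apply _).comp (comap_measurable _)
    exact ⟨_, X, fun l => hW.1 _, fun v => ⟨_, p, v, fun l =>
      grid_mem_Icc (Nat.le_of_lt_succ (e.symm l).1.2) (Nat.le_of_lt_succ (e.symm l).2.2), rfl⟩,
      hYm' n _ hX, hVm' n _ hX⟩
  have key1 := tendsto_integral_mul_comp_sub_zero hY hV hQ hVB hQB hVQ hΞ Real.measurable_cos
    Real.abs_cos_le_one (κ := 1) (by simp)
    (fun ξ hξ => by
      simpa only [hHre] using (hcos ξ hξ).integral_ofReal_mul_re (hΞ ξ hξ).cos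
        (fun _ => Real.abs_cos_le_one _) hHi)
    (fun ξ hξ => by
      simpa only [hHre] using (hsin ξ hξ).integral_ofReal_mul_re (hΞ ξ hξ).sin
        (fun _ => Real.abs_sin_le_one _) hHi) hcomap hZ
  have key2 := tendsto_integral_mul_comp_sub_zero hY hV hQ hVB hQB hVQ hΞ Real.measurable_sin
    Real.abs_sin_le_one (κ := 0) (by simp)
    (fun ξ hξ => by
      simpa only [hHim] using (hcos ξ hξ).integral_ofReal_mul_im (hΞ ξ hξ).cos
        (fun _ => Real.abs_cos_le_one _) hHi)
    (fun ξ hξ => by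
      simpa only [hHim] using (hsin ξ hξ).integral_ofReal_mul_im (hΞ ξ hξ).sin
        (fun _ => Real.abs_sin_le_one _) hHi) hcomap hZ
  have hZ1 : Integrable Z P := hZ.integrable one_le_two
  have hZ1' : Integrable (fun ω => (Z ω : ℂ)) P := hZ1.ofReal
  have hQe : ∀ ω, |Real.exp (-Q ω)| ≤ Real.exp B := fun ω => by
    rw [Real.abs_exp]
    exact Real.exp_le_exp.2 (by linarith [(abs_le.1 (hQB ω)).1])
  have hiQ : Integrable (fun ω => Z ω * Real.exp (-Q ω)) P :=
    hZ1.mul_bdd hQ.neg.exp.aestronglyMeasurable (ae_of_all _ hQe)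
  have hic : ∀ n, Integrable (fun ω => Z ω * Real.cos (Y n ω)) P := fun n =>
    hZ1.mul_bdd (hY n).cos.aestronglyMeasurable (ae_of_all _ fun _ => Real.abs_cos_le_one _)
  have his : ∀ n, Integrable (fun ω => Z ω * Real.sin (Y n ω)) P := fun n =>
    hZ1.mul_bdd (hY n).sin.aestronglyMeasurable (ae_of_all _ fun _ => Real.abs_sin_le_one _)
  have key1' : Tendsto (fun n => ∫ ω, Z ω * Real.cos (Y n ω) ∂P) atTop
      (𝓝 (∫ ω, Z ω * Real.exp (-Q ω) ∂P)) := by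
    rw [← tendsto_sub_nhds_zero_iff]
    refine key1.congr fun n => ?_
    rw [← integral_sub (hic n) hiQ]
    exact integral_congr_ae (ae_of_all _ fun ω => by simp only; ring)
  have key2' : Tendsto (fun n => ∫ ω, Z ω * Real.sin (Y n ω) ∂P) atTop (𝓝 0) := by
    simpa using key2
  have key := ((Complex.continuous_ofReal.tendsto _).comp key1').add
    (((Complex.continuous_ofReal.tendsto _).comp key2').mul_const Complex.I)
  have eQ : (∫ ω, (Z ω : ℂ) * Complex.exp (-(Q ω : ℂ)) ∂P) =
      ((∫ ω, Z ω * Real.exp (-Q ω) ∂P : ℝ) : ℂ) + ((0 : ℝ) : ℂ) * Complex.I := by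
    rw [← integral_complex_ofReal]
    simp
  have eY : ∀ n, (∫ ω, (Z ω : ℂ) * Complex.exp (Complex.I * (Y n ω : ℂ)) ∂P) =
      ((∫ ω, Z ω * Real.cos (Y n ω) ∂P : ℝ) : ℂ) +
        ((∫ ω, Z ω * Real.sin (Y n ω) ∂P : ℝ) : ℂ) * Complex.I := fun n => by
    rw [← integral_complex_ofReal, ← integral_complex_ofReal, ← integral_mul_const,
      ← integral_add (hic n).ofReal ((his n).ofReal.mul_const _)]
    refine integral_congr_ae (ae_of_all _ fun ω => ?_)
    simp only
    rw [mul_comm Complex.I, Complex.exp_mul_I]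
    push_cast
    ring
  rw [← eQ] at key
  exact key.congr fun n => (eY n).symm

/-- A Brownian sheet coincides almost surely with a Brownian sheet all of whose paths are
continuous. -/
lemma exists_continuous_modification (hW : IsBrownianSheet P W) :
    ∃ W', IsBrownianSheet P W' ∧ (∀ ω, Continuous fun z => W' z ω) ∧
      ∀ᵐ ω ∂P, ∀ z, W' z ω = W z ω := by
  classical
  obtain ⟨s, hs, hsm, hsP⟩ := Eventually.exists_measurable_mem hW.2.1
  let W' : ℝ × ℝ → Ω → ℝ := fun z => s.indicator (W z)
  have hae : ∀ᵐ ω ∂P, ∀ z, W' z ω = W z ω := by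
    filter_upwards [hs] with ω hω z
    exact Set.indicator_of_mem hω _
  have hc : ∀ ω, Continuous fun z => W' z ω := fun ω => by
    by_cases hω : ω ∈ s
    · simpa only [W', Set.indicator_of_mem hω] using hsP ω hω
    · simpa only [W', Set.indicator_of_notMem hω] using continuous_const
  refine ⟨W', ⟨fun z => (hW.1 z).indicator hsm, ae_of_all _ hc, fun m z hz c => ?_⟩, hc, hae⟩
  rw [← hW.2.2 m z hz c]
  refine Measure.map_congr ?_
  filter_upwards [hae] with ω hω
  simp only [hω]

end IsBrownianSheet

lemma wqv_congr {Ω : Type*} {W W' : ℝ × ℝ → Ω → ℝ} {ω : Ω} (h : ∀ z, W' z ω = W z ω) (f : ℝ → ℝ)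
    (n : ℕ) (s t : ℝ) : wqv W' f n s t ω = wqv W f n s t ω := by
  simp only [wqv, h]

/-- F-stable finite-dimensional convergence in law of the weighted quadratic variations
processes `Xⁿ` to `X_z = √2 ∫_{[0,z]} f(W_ρ) dB_ρ`: for all points `z_1,…,z_m` of `[0,1]²`,
reals `u_1,…,u_m` and every bounded random variable `Z`,
`E[Z exp(i ∑_k u_k Xⁿ_{z_k})] →
  E[Z exp(-∑_{k,k'} u_k u_{k'} ∫_{[0,s_k∧s_{k'}]×[0,t_k∧t_{k'}]} f(W_ρ)² dρ)]`. -/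
theorem stable_finite_dimensional_convergence_wqv
    {Ω : Type*} [MeasurableSpace Ω] (P : Measure Ω) [IsProbabilityMeasure P]
    (W : ℝ × ℝ → Ω → ℝ) (hW : IsBrownianSheet P W)
    (f : ℝ → ℝ) (hf : Measurable f) (C : ℝ) (hfC : ∀ x, |f x| ≤ C)
    (m : ℕ) (hm : 1 ≤ m) (z : Fin m → ℝ × ℝ)
    (hz : ∀ k, z k ∈ Set.Icc ((0:ℝ), (0:ℝ)) (1, 1))
    (u : Fin m → ℝ)
    (Z : Ω → ℝ) (hZ : Measurable Z) (K : ℝ) (hZK : ∀ ω, |Z ω| ≤ K) :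
    Tendsto
      (fun n : ℕ => ∫ ω, (Z ω : ℂ) *
        Complex.exp (Complex.I * ((∑ k, u k * wqv W f n (z k).1 (z k).2 ω : ℝ) : ℂ)) ∂P)
      atTop
      (𝓝 (∫ ω, (Z ω : ℂ) *
        Complex.exp (-((∑ k, ∑ k', u k * u k' *
          ∫ ρ in Set.Icc (0:ℝ) (min (z k).1 (z k').1) ×ˢ
              Set.Icc (0:ℝ) (min (z k).2 (z k').2),
            (f (W ρ ω)) ^ 2 : ℝ) : ℂ)) ∂P)) := by
  obtain ⟨W', hW', hWc, hae⟩ := hW.exists_continuous_modification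
  have key := hW'.tendsto_integral_mul_cexp_wqv hWc hf hfC hz u
    (MemLp.of_bound hZ.aestronglyMeasurable K (ae_of_all _ hZK))
  simp_rw [Fintype.sum_prod_type] at key
  convert key using 2
  · refine integral_congr_ae ?_
    filter_upwards [hae] with ω hω
    simp only [wqv_congr hω]
  · refine integral_congr_ae ?_
    filter_upwards [hae] with ω hω
    simp only [hω]
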